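/- Let A, B be unital C*-algebras, H a complex Hilbert space, ι : B → B(H) an isometric *-homomorphism, and suppose there exists a completely positive map P : B(H) → B with P(ι(b)) = b for all b ∈ B. Let T1, T2 : A → B be completely positive and let α ≥ 0 be such that for every n ≥ 1 and every x ∈ M_n(A), ‖((T1 − T2) applied entrywise)(x)‖ ≤ α·‖x‖ (i.e., the cb-norm of T1 − T2 is at most α). Then β(T1, T2)² ≤ α. -/

import Mathlib

noncomputable section

/-- A map between star algebras is *completely positive* if, for every `n`, its
entrywise application to `n × n` matrices maps positive elements (i.e. elements of the form
`star y * y`) to positive elements. -/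
def IsCPMap {A B : Type*} [NonUnitalSemiring A] [StarRing A]
    [NonUnitalSemiring B] [StarRing B] (T : A → B) : Prop :=
  ∀ (n : ℕ) (x : Matrix (Fin n) (Fin n) A),
    (∃ y : Matrix (Fin n) (Fin n) A, x = star y * y) →
      ∃ z : Matrix (Fin n) (Fin n) B, x.map T = star z * z

/-- `That : A → M₂(B)` is a cp extension of the pair `(T₁, T₂)`: it is completely positive
and its diagonal entries are `T₁` and `T₂`. -/
def IsCPExtension {A B : Type*} [CStarAlgebra A] [CStarAlgebra B]
    (T₁ T₂ : A → B) (That : A →ₗ[ℂ] Matrix (Fin 2) (Fin 2) B) : Prop :=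
  IsCPMap That ∧ (∀ a : A, That a 0 0 = T₁ a) ∧ (∀ a : A, That a 1 1 = T₂ a)

/-- The Bures distance between two completely positive maps `T₁ T₂ : A → B`:
`β(T₁,T₂) = √ inf { ‖T₁ 1 + T₂ 1 - T̂₁₂ 1 - T̂₂₁ 1‖ | T̂ a cp extension of (T₁, T₂) }`. -/
noncomputable def buresDist {A B : Type*} [CStarAlgebra A] [CStarAlgebra B]
    (T₁ T₂ : A → B) : ℝ :=
  Real.sqrt (sInf { r : ℝ | ∃ That : A →ₗ[ℂ] Matrix (Fin 2) (Fin 2) B,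
    IsCPExtension T₁ T₂ That ∧ r = ‖T₁ 1 + T₂ 1 - That 1 0 1 - That 1 1 0‖ })


/-- `ν` is a C*-norm on the star algebra `R`. -/
structure IsCStarNorm {R : Type*} [NonUnitalRing R] [StarRing R] [Module ℂ R]
    (ν : R → ℝ) : Prop where
  add_le : ∀ x y : R, ν (x + y) ≤ ν x + ν y
  smul_eq : ∀ (c : ℂ) (x : R), ν (c • x) = ‖c‖ * ν x
  eq_zero_iff : ∀ x : R, ν x = 0 ↔ x = 0
  mul_le : ∀ x y : R, ν (x * y) ≤ ν x * ν y
  star_mul_self : ∀ x : R, ν (star x * x) = ν x * ν x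

section

theorem aux_nonneg_iff {N : Type*} [CStarAlgebra N] [PartialOrder N] [StarOrderedRing N] (x : N) :
    0 ≤ x ↔ ∃ y, x = star y * y := CStarAlgebra.nonneg_iff_eq_star_mul_self

theorem aux_proj {N : Type*} [CStarAlgebra N] [PartialOrder N] [StarOrderedRing N]
    (p q : N) (hp : star p = p) (hpp : p * p = p) (hq : star q = q) (hqq : q * q = q) :
    ∃ C d : N, p * C = C ∧ star C * C + star d * d = q ∧
      (p + q - 1) + (p + q - 1) ≤ C + star C ∧
      ∀ x, Commute x p → Commute x q → Commute x C := by
  obtain ⟨s, hs⟩ : ∃ s, s = p + q - 1 := ⟨_, rfl⟩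
  have hss : star s = s := by rw [hs]; simp [hp, hq]
  have hps : p * (s * s) = p * q * p := by
    have e : p * (s * s) = p*q*p + (p*p-p)*(p+q-1) + p*q*q - p*q + p * q * p - p * q * p := by
      rw [hs]; noncomm_ring
    rw [e, hpp, mul_assoc p q q, hqq, sub_self, zero_mul]; abel
  have hsp : (s * s) * p = p * q * p := by
    have := congrArg star hps
    simpa [hss, hp, hq, mul_assoc] using this
  have hqs : q * (s * s) = q * p * q := by
    have e : q * (s * s) = q*p*q + (q*q-q)*(p+q-1) + q*p*p - q*p + q * p * q - q * p * q := by
      rw [hs]; noncomm_ring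
    rw [e, hqq, mul_assoc q p p, hpp, sub_self, zero_mul]; abel
  have hsq : (s * s) * q = q * p * q := by
    have := congrArg star hqs
    simpa [hss, hp, hq, mul_assoc] using this
  have hpq : p * q + q * p = s * s + s := by
    have e : s * s + s = p * q + q * p + (p * p - p) + (q * q - q) := by
      rw [hs]; noncomm_ring
    rw [e, hpp, hqq]; abel
  have h1 : (1 : N) ≤ 1 + s * s := by
    have := star_mul_self_nonneg s
    rw [hss] at this
    simpa using this
  have hu : IsUnit (1 + s * s) := CStarAlgebra.isUnit_of_le 1 h1 (by exact isStrictlyPositive_one)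
  obtain ⟨u, hu⟩ := hu
  obtain ⟨z, hz⟩ : ∃ z : N, z = ((u⁻¹ : Nˣ) : N) := ⟨_, rfl⟩
  have hz1 : z * (1 + s * s) = 1 := by rw [hz, ← hu]; simp
  have hz2 : (1 + s * s) * z = 1 := by rw [hz, ← hu]; simp
  have hzc : ∀ x, Commute x (1 + s * s) → Commute x z := by
    intro x hx
    rw [hz]
    rw [← hu] at hx
    exact hx.units_inv_right
  have hzs : star z = z := by
    have h3 : star z * (1 + s * s) = 1 := by
      have := congrArg star hz2
      simpa [hss] using this
    calc star z = star z * ((1 + s * s) * z) := by rw [hz2, mul_one]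
      _ = z := by rw [← mul_assoc, h3, one_mul]
  have hzp : Commute p z := hzc p (by
    refine (Commute.one_right p).add_right ?_
    show p * (s * s) = (s * s) * p
    rw [hps, hsp])
  have hzq : Commute q z := hzc q (by
    refine (Commute.one_right q).add_right ?_
    show q * (s * s) = (s * s) * q
    rw [hqs, hsq])
  have hzS : Commute s z := hzc s (by
    refine (Commute.one_right s).add_right ?_
    show s * (s * s) = (s * s) * s
    rw [mul_assoc])
  have hqS : Commute q (s * s) := by
    show q * (s * s) = (s * s) * q
    rw [hqs, hsq]
  have e1 : star (z * p * q) = z * (q * p) := by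
    simp only [star_mul, hp, hq, hzs]
    rw [hzp.eq, ← mul_assoc, hzq.eq, mul_assoc]
  have hzz : Commute q (z * z) := hzq.mul_right hzq
  have e2 : star (z * p * q) * (z * p * q) = z * z * (s * s) * q := by
    calc star (z * p * q) * (z * p * q) = z * (q * (p * z) * p * q) := by
          rw [e1]; simp only [mul_assoc]
      _ = z * ((q * z) * (p * p) * q) := by rw [hzp.eq]; simp only [mul_assoc]
      _ = z * z * (q * p * q) := by rw [hpp, hzq.eq]; simp only [mul_assoc]
      _ = z * z * (s * s) * q := by rw [← hsq]; simp only [mul_assoc]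
  have hzSS : Commute (s * s) z := hzS.mul_left hzS
  have e3 : star (q * ((1 - s * s) * z)) * (q * ((1 - s * s) * z)) =
      z * z * ((1 - s * s) * (1 - s * s)) * q := by
    have c1 : Commute (1 - s * s) z := (Commute.one_left z).sub_left hzSS
    have c2 : Commute q (1 - s * s) := (Commute.one_right q).sub_right hqS
    have e4 : star (q * ((1 - s * s) * z)) = z * (1 - s * s) * q := by
      simp [hss, hq, hzs]
    calc star (q * ((1 - s * s) * z)) * (q * ((1 - s * s) * z))
        = z * ((1 - s * s) * (q * q) * ((1 - s * s) * z)) := by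
          rw [e4]; simp only [mul_assoc]
      _ = z * ((1 - s * s) * (q * (z * (1 - s * s)))) := by
          rw [hqq, c1.eq]; simp only [mul_assoc]
      _ = z * ((1 - s * s) * (z * (q * (1 - s * s)))) := by
          rw [← mul_assoc q, hzq.eq, mul_assoc]
      _ = z * (((1 - s * s) * z) * ((1 - s * s) * q)) := by
          rw [c2.eq]; simp only [mul_assoc]
      _ = _ := by rw [c1.eq]; simp only [mul_assoc]
  refine ⟨z * p * q + z * p * q, q * ((1 - s * s) * z), ?_, ?_, ?_, ?_⟩
  · have : p * (z * p * q) = z * p * q := by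
      rw [← mul_assoc, ← mul_assoc, hzp.eq, mul_assoc z p p, hpp]
    rw [mul_add, this]
  · rw [star_add, e3]
    have : (star (z * p * q) + star (z * p * q)) * (z * p * q + z * p * q)
      = z * z * ((s * s) + (s * s) + (s * s) + (s * s)) * q := by
      simp only [add_mul, mul_add, e2]; abel
    rw [this, ← add_mul, ← mul_add]
    have : s * s + s * s + s * s + s * s + (1 - s * s) * (1 - s * s)
      = (1 + s * s) * (1 + s * s) := by noncomm_ring
    rw [this]
    have : z * z * ((1 + s * s) * (1 + s * s)) = 1 := by
      rw [mul_assoc, ← mul_assoc z _ (1 + s * s), hz1, one_mul, hz1]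
    rw [this, one_mul]
  · rw [← hs, star_add, e1]
    have h1s : 0 ≤ 1 - s := by
      have hA : 0 ≤ star (1 - p) * (1 - p) := star_mul_self_nonneg _
      have hB : 0 ≤ star (1 - q) * (1 - q) := star_mul_self_nonneg _
      have : 1 - s = star (1 - p) * (1 - p) + star (1 - q) * (1 - q) := by
        simp only [star_sub, star_one, hp, hq]
        have : (1 - p) * (1 - p) + (1 - q) * (1 - q) =
          (1 - p + (p * p - p)) + (1 - q + (q * q - q)) := by noncomm_ring
        rw [this, hpp, hqq, hs]; noncomm_ring
      rw [this]; exact add_nonneg hA hB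
    have hk : 0 ≤ star (z * s) * (1 - s) * (z * s) + star (z * (s * s)) * (1 - s) * (z * (s * s)) :=
      add_nonneg (star_left_conjugate_nonneg h1s _) (star_left_conjugate_nonneg h1s _)
    have c1 : Commute (1 - s) z := (Commute.one_left z).sub_left hzS
    have hk2 : star (z * s) * (1 - s) * (z * s) + star (z * (s * s)) * (1 - s) * (z * (s * s))
        = z * (p * q) + z * (q * p) - s := by
      have a1 : star (z * s) * (1 - s) * (z * s) = z * z * (s * ((1 - s) * s)) := by
        simp only [star_mul, hss, hzs]
        calc s * z * (1 - s) * (z * s) = (s * z) * (((1 - s) * z) * s) := by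
              simp only [mul_assoc]
          _ = (z * s) * ((z * (1 - s)) * s) := by rw [c1.eq, hzS.eq]
          _ = z * ((s * z) * ((1 - s) * s)) := by simp only [mul_assoc]
          _ = z * ((z * s) * ((1 - s) * s)) := by rw [hzS.eq]
          _ = _ := by simp only [mul_assoc]
      have a2 : star (z * (s * s)) * (1 - s) * (z * (s * s)) =
          z * z * ((s * s) * ((1 - s) * (s * s))) := by
        simp only [star_mul, hss, hzs]
        calc s * s * z * (1 - s) * (z * (s * s)) = ((s * s) * z) * (((1 - s) * z) * (s * s)) := by
              simp only [mul_assoc]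
          _ = (z * (s * s)) * ((z * (1 - s)) * (s * s)) := by rw [c1.eq, hzSS.eq]
          _ = z * (((s * s) * z) * ((1 - s) * (s * s))) := by simp only [mul_assoc]
          _ = z * ((z * (s * s)) * ((1 - s) * (s * s))) := by rw [hzSS.eq]
          _ = _ := by simp only [mul_assoc]
      rw [a1, a2, ← mul_add, ← mul_add z, hpq]
      have : s * ((1 - s) * s) + (s * s) * ((1 - s) * (s * s)) =
        (1 + s * s) * (s * s * (1 - s)) := by noncomm_ring
      rw [this, mul_assoc, ← mul_assoc z (1 + s * s), hz1, one_mul]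
      have : s = z * ((1 + s * s) * s) := by rw [← mul_assoc, hz1, one_mul]
      calc z * (s * s * (1 - s)) = z * (s * s + s) - z * ((1 + s * s) * s) := by noncomm_ring
        _ = _ := by rw [← this]
    rw [hk2] at hk
    have : s ≤ z * (p * q) + z * (q * p) := by simpa using hk
    have h2 := add_le_add this this
    rw [mul_assoc]
    calc s + s ≤ _ := h2
      _ = _ := by abel
  · intro x hxp hxq
    have hxs : Commute x s := by
      rw [hs]; exact (hxp.add_right hxq).sub_right (Commute.one_right x)
    have hxz : Commute x z := hzc x ((Commute.one_right x).add_right (hxs.mul_right hxs))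
    have := (hxz.mul_right hxp).mul_right hxq
    exact this.add_right this

theorem aux_block {R : Type*} [CStarAlgebra R] [PartialOrder R] [StarOrderedRing R]
    (D₁ D₂ : R) (h1 : 0 ≤ D₁) (h1' : D₁ ≤ 1) (h2 : 0 ≤ D₂) (h2' : D₂ ≤ 1) :
    ∃ (C : R) (a b d : Fin 2 → R), D₁ = ∑ k, star (a k) * a k ∧ C = ∑ k, star (a k) * b k ∧
      D₂ = ∑ k, (star (b k) * b k + star (d k) * d k) ∧
      (D₁ + D₂ - 1) + (D₁ + D₂ - 1) ≤ C + star C ∧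
      ∀ x, Commute x D₁ → Commute x D₂ → Commute x C := by
  have key : ∀ D : R, 0 ≤ D → D ≤ 1 → ∃ p : CStarMatrix (Fin 2) (Fin 2) R,
      star p = p ∧ p * p = p ∧ p 0 0 = D ∧
      ∀ x, Commute x D → Commute (CStarMatrix.ofMatrix (Matrix.diagonal fun _ : Fin 2 => x)) p := by
    intro D hD hD'
    have hDD : 0 ≤ D * (1 - D) := by
      refine Commute.mul_nonneg hD (sub_nonneg.2 hD') ?_
      exact (Commute.one_right D).sub_right (Commute.refl D)
    obtain ⟨r, hr⟩ : ∃ r, r = CFC.sqrt (D * (1 - D)) := ⟨_, rfl⟩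
    have hrr : r * r = D * (1 - D) := by rw [hr]; exact CFC.sqrt_mul_sqrt_self _ hDD
    have hrs : star r = r := by
      rw [hr]; exact (IsSelfAdjoint.of_nonneg (CFC.sqrt_nonneg _)).star_eq
    have hDs : star D = D := (IsSelfAdjoint.of_nonneg hD).star_eq
    have hrc : ∀ x, Commute x D → Commute x r := by
      intro x hx
      have : Commute x (D * (1 - D)) := hx.mul_right ((Commute.one_right x).sub_right hx)
      rw [hr]
      exact (Commute.cfcₙ_nnreal this.symm _).symm
    have hDr := hrc D (Commute.refl D)
    refine ⟨CStarMatrix.ofMatrix !![D, r; r, 1 - D], ?_, ?_, ?_, ?_⟩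
    · ext i j
      fin_cases i <;> fin_cases j <;> simp [CStarMatrix.star_apply, hrs, hDs]
    · ext i j
      fin_cases i <;> fin_cases j <;> simp [CStarMatrix.mul_apply, hrr, mul_sub, sub_mul, hDr.eq]
    · simp
    · intro x hx
      have hxr := hrc x hx
      show _ * _ = _ * _
      ext i j
      fin_cases i <;> fin_cases j <;>
        simp [CStarMatrix.mul_apply, Matrix.diagonal, hxr.eq, hx.eq, mul_sub, sub_mul]
  obtain ⟨p, hp, hpp, hp0, hpc⟩ := key D₁ h1 h1'
  obtain ⟨q, hq, hqq, hq0, hqc⟩ := key D₂ h2 h2'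
  obtain ⟨C, d, hC1, hC2, hC3, hC4⟩ := aux_proj p q hp hpp hq hqq
  refine ⟨C 0 0, fun k => p k 0, fun k => C k 0, fun k => d k 0, ?_, ?_, ?_, ?_, ?_⟩
  · rw [← hp0]
    have := congrFun (congrFun hpp 0) 0
    rw [← this, CStarMatrix.mul_apply]
    refine Finset.sum_congr rfl fun k _ => ?_
    conv_lhs => rw [← hp]
    rw [CStarMatrix.star_apply, hp]
  · have := congrFun (congrFun hC1 0) 0
    rw [← this, CStarMatrix.mul_apply]
    refine Finset.sum_congr rfl fun k _ => ?_
    conv_lhs => rw [← hp]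
    rw [CStarMatrix.star_apply]
  · rw [← hq0, ← hC2, Finset.sum_add_distrib, CStarMatrix.add_apply, CStarMatrix.mul_apply,
      CStarMatrix.mul_apply]
    simp only [CStarMatrix.star_apply]
  · rw [← sub_nonneg] at hC3 ⊢
    obtain ⟨Z, hZ⟩ := (aux_nonneg_iff _).1 hC3
    have := congrFun (congrFun hZ 0) 0
    simp only [CStarMatrix.add_apply, CStarMatrix.sub_apply, CStarMatrix.mul_apply,
      CStarMatrix.star_apply, hp0, hq0, CStarMatrix.one_apply_eq] at this
    rw [this]
    exact Finset.sum_nonneg fun k _ => star_mul_self_nonneg _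
  · intro x hx1 hx2
    have := hC4 _ (hpc x hx1) (hqc x hx2)
    have := congrFun (congrFun this.eq 0) 0
    show x * C 0 0 = C 0 0 * x
    simpa [CStarMatrix.mul_apply, Matrix.diagonal] using this

end

section

open scoped ComplexOrder in
theorem aux_rn {M : Type*} [CStarAlgebra M] [PartialOrder M] [StarOrderedRing M]
    (f g : M →ₚ[ℂ] ℂ) (h : ∀ x, f (star x * x) ≤ g (star x * x)) :
    ∃ D : g.GNS →L[ℂ] g.GNS, 0 ≤ D ∧ D ≤ 1 ∧ (∀ a, Commute (g.gnsStarAlgHom a) D) ∧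
      ∀ x y : M, inner ℂ ((g.toPreGNS x : g.PreGNS) : g.GNS)
        (D ((g.toPreGNS y : g.PreGNS) : g.GNS)) = f (star x * y) := by
  let J0 : g.PreGNS →L[ℂ] f.PreGNS :=
    (f.toPreGNS.toLinearMap ∘ₗ g.ofPreGNS.toLinearMap).mkContinuous 1 (by
      intro x
      rw [one_mul, PositiveLinearMap.preGNS_norm_def, PositiveLinearMap.preGNS_norm_def]
      apply Real.sqrt_le_sqrt
      exact (Complex.le_def.1 (h (g.ofPreGNS x))).1)
  have hJ0 : ‖J0‖ ≤ 1 := LinearMap.mkContinuous_norm_le _ zero_le_one _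
  let J : g.GNS →L[ℂ] f.GNS := J0.completion
  have hJc : ∀ x : g.PreGNS, J (x : g.GNS) = ((J0 x : f.PreGNS) : f.GNS) := by
    intro x
    exact ContinuousLinearMap.completion_apply_coe _ _
  have hJn : ∀ x, ‖J x‖ ≤ ‖x‖ := by
    intro x
    induction x using UniformSpace.Completion.induction_on with
    | hp => exact isClosed_le (by fun_prop) (by fun_prop)
    | ih x =>
      rw [hJc]
      simp only [UniformSpace.Completion.norm_coe]
      simpa using J0.le_of_opNorm_le hJ0 x
  have hcomm : ∀ a, J ∘L (g.gnsStarAlgHom a) = (f.gnsStarAlgHom a) ∘L J := by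
    intro a
    ext x
    induction x using UniformSpace.Completion.induction_on with
    | hp => apply isClosed_eq <;> fun_prop
    | ih x =>
      simp [hJc]
      rfl
  refine ⟨ContinuousLinearMap.adjoint J ∘L J, ?_, ?_, ?_, ?_⟩
  · rw [ContinuousLinearMap.nonneg_iff_isPositive]
    exact ContinuousLinearMap.isPositive_adjoint_comp_self J
  · rw [ContinuousLinearMap.le_def, ContinuousLinearMap.isPositive_def]
    refine ⟨?_, ?_⟩
    · intro x y
      simp [inner_sub_left, inner_sub_right, ContinuousLinearMap.adjoint_inner_left,
        ContinuousLinearMap.adjoint_inner_right]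
    · intro x
      have := hJn x
      simp [ContinuousLinearMap.reApplyInnerSelf, inner_sub_left,
        ContinuousLinearMap.adjoint_inner_left]
      rw [← Complex.ofReal_pow, ← Complex.ofReal_pow, Complex.ofReal_re, Complex.ofReal_re]
      gcongr
  · intro a
    have h1 := hcomm a
    have h2 := congrArg ContinuousLinearMap.adjoint (hcomm (star a))
    rw [ContinuousLinearMap.adjoint_comp, ContinuousLinearMap.adjoint_comp, map_star g.gnsStarAlgHom, map_star f.gnsStarAlgHom,
      ContinuousLinearMap.star_eq_adjoint, ContinuousLinearMap.star_eq_adjoint,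
      ContinuousLinearMap.adjoint_adjoint, ContinuousLinearMap.adjoint_adjoint] at h2
    show (g.gnsStarAlgHom a) ∘L (ContinuousLinearMap.adjoint J ∘L J) =
      (ContinuousLinearMap.adjoint J ∘L J) ∘L (g.gnsStarAlgHom a)
    rw [ContinuousLinearMap.comp_assoc, h1, ← ContinuousLinearMap.comp_assoc, h2,
      ContinuousLinearMap.comp_assoc]
  · intro x y
    rw [ContinuousLinearMap.comp_apply, ContinuousLinearMap.adjoint_inner_right, hJc, hJc,
      UniformSpace.Completion.inner_coe]
    rfl

open scoped ComplexOrder in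
theorem aux_gns {M : Type*} [CStarAlgebra M] [PartialOrder M] [StarOrderedRing M]
    (f₁ f₂ f : M →ₗ[ℂ] ℂ) (h1 : ∀ x, 0 ≤ f₁ (star x * x)) (h2 : ∀ x, 0 ≤ f₂ (star x * x))
    (h3 : ∀ x, f₁ (star x * x) - f₂ (star x * x) ≤ f (star x * x))
    (h4 : ∀ x, f₂ (star x * x) - f₁ (star x * x) ≤ f (star x * x)) :
    ∃ c : M →ₗ[ℂ] ℂ,
      (∀ x y, 0 ≤ (f₁ (star x * x)).re + 2 * (c (star x * y)).re + (f₂ (star y * y)).re) ∧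
      (∀ x, (f₁ (star x * x)).re + (f₂ (star x * x)).re - 2 * (c (star x * x)).re
        ≤ (f (star x * x)).re) := by
  let σ0 : M →ₗ[ℂ] ℂ := (2⁻¹ : ℂ) • (f₁ + f₂ + f)
  have h2' : (0 : ℂ) ≤ 2⁻¹ := by norm_num [Complex.le_def]
  have hσ1 : ∀ x, f₁ (star x * x) ≤ σ0 (star x * x) := by
    intro x
    have := mul_le_mul_of_nonneg_left (h3 x) h2'
    have e : σ0 (star x * x) = f₁ (star x * x) + (2⁻¹ * f (star x * x) -
      2⁻¹ * (f₁ (star x * x) - f₂ (star x * x))) := by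
      simp [σ0]; ring
    rw [e]
    simpa using this
  have hσ2 : ∀ x, f₂ (star x * x) ≤ σ0 (star x * x) := by
    intro x
    have := mul_le_mul_of_nonneg_left (h4 x) h2'
    have e : σ0 (star x * x) = f₂ (star x * x) + (2⁻¹ * f (star x * x) -
      2⁻¹ * (f₂ (star x * x) - f₁ (star x * x))) := by
      simp [σ0]; ring
    rw [e]
    simpa using this
  have mkpos : ∀ φ : M →ₗ[ℂ] ℂ, (∀ x, 0 ≤ φ (star x * x)) → ∀ x, 0 ≤ x → 0 ≤ φ x := by
    intro φ hφ x hx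
    obtain ⟨y, rfl⟩ := (aux_nonneg_iff x).1 hx
    exact hφ y
  let g₁ : M →ₚ[ℂ] ℂ := PositiveLinearMap.mk₀ f₁ (mkpos f₁ h1)
  let g₂ : M →ₚ[ℂ] ℂ := PositiveLinearMap.mk₀ f₂ (mkpos f₂ h2)
  let σ : M →ₚ[ℂ] ℂ := PositiveLinearMap.mk₀ σ0 (mkpos σ0 fun x => (h1 x).trans (hσ1 x))
  obtain ⟨D₁, hD1, hD1', hD1c, hD1i⟩ := aux_rn g₁ σ hσ1
  obtain ⟨D₂, hD2, hD2', hD2c, hD2i⟩ := aux_rn g₂ σ hσ2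
  obtain ⟨C, a, b, d, e1, e2, e3, e4, e5⟩ := aux_block D₁ D₂ hD1 hD1' hD2 hD2'
  have hC : ∀ x, Commute (σ.gnsStarAlgHom x) C := fun x => e5 _ (hD1c x) (hD2c x)
  let v : M → σ.GNS := fun x => ((σ.toPreGNS x : σ.PreGNS) : σ.GNS)
  have hv : ∀ x y, σ.gnsStarAlgHom x (v y) = v (x * y) := by
    intro x y
    simp [v]
  let c : M →ₗ[ℂ] ℂ :=
    { toFun := fun x => inner ℂ (v 1) (C (σ.gnsStarAlgHom x (v 1)))
      map_add' := by intro x y; simp [inner_add_right]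
      map_smul' := by intro r x; simp [inner_smul_right] }
  have hc : ∀ x y, c (star x * y) = inner ℂ (v x) (C (v y)) := by
    intro x y
    show inner ℂ (v 1) (C (σ.gnsStarAlgHom (star x * y) (v 1))) = _
    have h5 : C (σ.gnsStarAlgHom (star x) (v y)) = σ.gnsStarAlgHom (star x) (C (v y)) := by
      have := (hC (star x)).eq
      exact (congrArg (fun T : σ.GNS →L[ℂ] σ.GNS => T (v y)) this).symm
    rw [hv, mul_one, ← hv, h5, map_star σ.gnsStarAlgHom, ContinuousLinearMap.star_eq_adjoint,
      ContinuousLinearMap.adjoint_inner_right, hv, mul_one]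
  have i1 : ∀ x y, f₁ (star x * y) = inner ℂ (v x) (D₁ (v y)) := fun x y => (hD1i x y).symm
  have i2 : ∀ x y, f₂ (star x * y) = inner ℂ (v x) (D₂ (v y)) := fun x y => (hD2i x y).symm
  have i3 : ∀ x y, σ0 (star x * y) = inner ℂ (v x) (v y) := fun x y => by
    simp only [v, UniformSpace.Completion.inner_coe]
    rfl
  refine ⟨c, ?_, ?_⟩
  · intro x y
    rw [hc, i1, i2, e1, e2, e3]
    have : ∀ k, 0 ≤ (inner ℂ (v x) ((star (a k) * a k) (v x)) : ℂ).re
        + 2 * (inner ℂ (v x) ((star (a k) * b k) (v y)) : ℂ).re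
        + (inner ℂ (v y) ((star (b k) * b k + star (d k) * d k) (v y)) : ℂ).re := by
      intro k
      have n1 := inner_self_nonneg (𝕜 := ℂ) (x := a k (v x) + b k (v y))
      have n2 := inner_self_nonneg (𝕜 := ℂ) (x := d k (v y))
      have n3 := inner_re_symm (𝕜 := ℂ) (a k (v x)) (b k (v y))
      simp only [inner_add_left, inner_add_right, map_add, RCLike.re_to_complex] at n1 n2 n3
      simp only [ContinuousLinearMap.star_eq_adjoint, ContinuousLinearMap.mul_apply,
        ContinuousLinearMap.add_apply, ContinuousLinearMap.adjoint_inner_right, inner_add_right,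
        Complex.add_re]
      linarith
    have h0 := this 0
    have h1 := this 1
    simp only [Fin.sum_univ_two, ContinuousLinearMap.add_apply, inner_add_right,
      Complex.add_re] at h0 h1 ⊢
    linarith
  · intro x
    have hp := ((ContinuousLinearMap.le_def _ _).1 e4).inner_nonneg_right (v x)
    have hp' := (Complex.le_def.1 hp).1
    have e6 : (f (star x * x)) = 2 * σ0 (star x * x) - f₁ (star x * x) - f₂ (star x * x) := by
      simp [σ0]; ring
    have e7 : (inner ℂ (v x) ((star C) (v x)) : ℂ).re = (inner ℂ (v x) (C (v x)) : ℂ).re := by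
      rw [ContinuousLinearMap.star_eq_adjoint, ContinuousLinearMap.adjoint_inner_right]
      exact inner_re_symm (𝕜 := ℂ) _ _
    rw [e6, hc, i1, i2, i3]
    simp only [ContinuousLinearMap.add_apply, ContinuousLinearMap.sub_apply, inner_add_right,
      inner_sub_right, Complex.add_re, Complex.sub_re, e7, Complex.zero_re,
      ContinuousLinearMap.one_apply] at hp'
    simp only [Complex.sub_re, Complex.mul_re, Complex.re_ofNat, Complex.im_ofNat, zero_mul, sub_zero]
    linarith

end

section

theorem aux_nu_nonneg {M : Type*} [CStarAlgebra M] (ν : M → ℝ) (hν : IsCStarNorm ν) (x : M) :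
    0 ≤ ν x := by
  have h0 : ν 0 = 0 := (hν.eq_zero_iff 0).2 rfl
  have h1 := hν.add_le x ((-1 : ℂ) • x)
  have h2 := hν.smul_eq (-1) x
  have : x + (-1 : ℂ) • x = 0 := by simp
  rw [this, h0] at h1
  simp at h2
  simp at h1
  linarith

theorem aux_nu_le_one {M : Type*} [CStarAlgebra M] (ν : M → ℝ) (hν : IsCStarNorm ν) (x : M)
    (hx : IsSelfAdjoint x) (hx1 : ‖x‖ ≤ 1) : ν x ≤ 1 := by
  let _ := CStarAlgebra.spectralOrder M
  have _ := CStarAlgebra.spectralOrderedRing M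
  have hn := aux_nu_nonneg ν hν
  have hone : ν 1 ≤ 1 := by
    have := hν.star_mul_self 1
    rw [star_one, mul_one] at this
    nlinarith [hn 1]
  have hu : ∀ u : unitary M, ν (u : M) ≤ 1 := by
    intro u
    have := hν.star_mul_self (u : M)
    simp at this
    nlinarith [hn (u : M)]
  let u := selfAdjoint.unitarySelfAddISMul ⟨x, hx⟩ hx1
  have h1 : (u : M) + star (u : M) = (2 : ℂ) • x := by
    have := selfAdjoint.realPart_unitarySelfAddISMul ⟨x, hx⟩ hx1
    have h2 := congrArg (Subtype.val) this
    rw [realPart_apply_coe] at h2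
    simp only at h2
    rw [← h2, ← Complex.coe_smul, smul_smul]
    simp [u]
  have h2 := hν.add_le (u : M) (star (u : M))
  rw [h1, hν.smul_eq] at h2
  have h3 := hu u
  have h4 := hu (star u)
  simp at h2 h4
  linarith

theorem aux_nu_le {M : Type*} [CStarAlgebra M] (ν : M → ℝ) (hν : IsCStarNorm ν) (x : M)
    (hx : IsSelfAdjoint x) : ν x ≤ ‖x‖ := by
  by_cases h : x = 0
  · rw [(hν.eq_zero_iff x).2 h]; exact norm_nonneg _
  have hp : 0 < ‖x‖ := norm_pos_iff.2 h
  have h1 := aux_nu_le_one ν hν (((‖x‖⁻¹ : ℝ) : ℂ) • x) (by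
    rw [Complex.coe_smul]; exact IsSelfAdjoint.smul (IsSelfAdjoint.all (‖x‖⁻¹ : ℝ)) hx) (by
    rw [norm_smul]; simp [hp.ne'])
  rw [hν.smul_eq] at h1
  simp at h1
  field_simp at h1
  linarith

theorem aux_nu_le_smul {M : Type*} [CStarAlgebra M] [PartialOrder M] [StarOrderedRing M]
    (ν : M → ℝ) (hν : IsCStarNorm ν) (x : M)
    (hx : IsSelfAdjoint x) (c : ℝ) (hc : ν x < c) : x ≤ (c : ℂ) • (1 : M) := by
  rw [Complex.coe_smul, ← Algebra.algebraMap_eq_smul_one]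
  have hn := aux_nu_nonneg ν hν
  have hc0 : 0 < c := (hn x).trans_lt hc
  rw [le_algebraMap_iff_spectrum_le]
  set d := cfc (fun t : ℝ => max (t - c) 0) x with hd
  have hw : ∀ m : ℕ, Continuous (fun t : ℝ => max (t - c) 0 * ((max t c)⁻¹) ^ m) := by
    intro m
    have : ∀ t : ℝ, max t c ≠ 0 := fun t => (lt_max_of_lt_right hc0).ne'
    fun_prop (disch := exact this _)
  have key : ∀ m : ℕ, ν d ≤ (ν x / c) ^ m * (‖x‖ + c) := by
    intro m
    set w := cfc (fun t : ℝ => max (t - c) 0 * ((max t c)⁻¹) ^ m) x with hwd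
    have e1 : d = x ^ m * w := by
      rw [hd, hwd, ← cfc_pow_id (R := ℝ) x m, ← cfc_mul _ _ x (by fun_prop) (hw m).continuousOn]
      apply cfc_congr
      intro t _
      simp only
      rcases le_total t c with h | h
      · simp [h]
      · rw [max_eq_left h, mul_left_comm, inv_pow, mul_inv_cancel₀ (pow_ne_zero _ (hc0.trans_le h).ne'),
          mul_one]
    have e2 : ∀ k : ℕ, ∀ y, ν (x ^ k * y) ≤ ν x ^ k * ν y := by
      intro k
      induction k with
      | zero => intro y; simp
      | succ k ih =>
        intro y
        rw [pow_succ, mul_assoc, pow_succ, mul_assoc]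
        refine (ih _).trans ?_
        have := hn x
        gcongr
        exact hν.mul_le _ _
    have hws : IsSelfAdjoint w := cfc_predicate _ _
    have e3 : ‖w‖ ≤ (‖x‖ + c) * (c⁻¹) ^ m := by
      apply norm_cfc_le (by positivity)
      intro t ht
      have ht2 : |t| ≤ ‖x‖ := by
        obtain (_ | _) := subsingleton_or_nontrivial M
        · exact absurd (isUnit_of_subsingleton _) ht
        · exact spectrum.norm_le_norm_of_mem ht
      have h3 : 0 ≤ max (t - c) 0 := le_max_right _ _
      have h4 : 0 < max t c := lt_max_of_lt_right hc0
      rw [Real.norm_eq_abs, abs_of_nonneg (by positivity)]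
      gcongr
      · have := le_abs_self t
        have := norm_nonneg x
        rw [max_le_iff]
        constructor <;> linarith
      · exact le_max_right _ _
    have e4 : ν w ≤ ‖w‖ := aux_nu_le ν hν w hws
    calc ν d ≤ ν x ^ m * ν w := by rw [e1]; exact e2 m w
      _ ≤ ν x ^ m * ((‖x‖ + c) * (c⁻¹) ^ m) := by
          have := hn x
          gcongr
          exact e4.trans e3
      _ = _ := by rw [div_eq_mul_inv, mul_pow]; ring
  have hd0 : d = 0 := by
    rw [← hν.eq_zero_iff]
    refine le_antisymm ?_ (hn d)
    have ht : Filter.Tendsto (fun m : ℕ => (ν x / c) ^ m * (‖x‖ + c)) Filter.atTop (nhds (0 * (‖x‖ + c))) := by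
      apply Filter.Tendsto.mul_const
      exact tendsto_pow_atTop_nhds_zero_of_lt_one (div_nonneg (hn x) hc0.le) ((div_lt_one hc0).2 hc)
    rw [zero_mul] at ht
    exact ge_of_tendsto' ht key
  intro t ht
  have h5 : max (t - c) 0 ∈ spectrum ℝ d := by
    rw [hd, cfc_map_spectrum (fun t : ℝ => max (t - c) 0) x]
    exact ⟨t, ht, rfl⟩
  rw [hd0] at h5
  have : max (t - c) 0 = 0 := by
    by_contra h
    apply h5
    rw [spectrum.mem_resolventSet_iff, sub_zero]
    exact (IsUnit.mk0 _ h).map (algebraMap ℝ M)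
  have := le_max_left (t - c) 0
  linarith

end

section

/-- quadratic form of the amplification of `S` -/
noncomputable def auxQf {A H : Type*} [CStarAlgebra A] [NormedAddCommGroup H] [InnerProductSpace ℂ H]
    (S : A →ₗ[ℂ] (H →L[ℂ] H)) {n : ℕ} (w : Fin n → H) :
    CStarMatrix (Fin n) (Fin n) A →ₗ[ℂ] ℂ where
  toFun x := ∑ i, ∑ j, inner ℂ (w i) (S (x i j) (w j))
  map_add' x y := by
    simp only [CStarMatrix.add_apply, map_add, add_apply, inner_add_right, Finset.sum_add_distrib]
  map_smul' c x := by
    simp only [CStarMatrix.smul_apply, map_smul, smul_apply, inner_smul_right, Finset.mul_sum, RingHom.id_apply, smul_eq_mul]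

theorem auxQf_apply {A H : Type*} [CStarAlgebra A] [NormedAddCommGroup H] [InnerProductSpace ℂ H]
    (S : A →ₗ[ℂ] (H →L[ℂ] H)) {n : ℕ} (w : Fin n → H) (x : CStarMatrix (Fin n) (Fin n) A) :
    auxQf S w x = ∑ i, ∑ j, inner ℂ (w i) (S (x i j) (w j)) := rfl

theorem aux_cp_nonneg {A B : Type*} [CStarAlgebra A] [CStarAlgebra B]
    (T : A →ₗ[ℂ] B) (hT : IsCPMap T) (y : A) : ∃ z : B, T (star y * y) = star z * z := by
  obtain ⟨z, hz⟩ := hT 1 (Matrix.of fun _ _ => star y * y) ⟨Matrix.of fun _ _ => y, by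
    ext i j; simp [Matrix.mul_apply, Matrix.star_apply]⟩
  refine ⟨z 0 0, ?_⟩
  have := congrFun (congrFun hz 0) 0
  simpa [Matrix.mul_apply, Matrix.star_apply] using this

theorem aux_cp_star {A B : Type*} [CStarAlgebra A] [CStarAlgebra B]
    (T : A →ₗ[ℂ] B) (hT : IsCPMap T) (a : A) : T (star a) = star (T a) := by
  let _ := CStarAlgebra.spectralOrder A
  have _ := CStarAlgebra.spectralOrderedRing A
  have h : a ∈ Submodule.span ℂ {a : A | 0 ≤ a} := by
    rw [CStarAlgebra.span_nonneg]; trivial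
  induction h using Submodule.span_induction with
  | mem x hx =>
    obtain ⟨y, rfl⟩ := (aux_nonneg_iff x).1 hx
    obtain ⟨z, hz⟩ := aux_cp_nonneg T hT y
    simp [hz]
  | zero => simp
  | add x y _ _ h1 h2 => simp [h1, h2]
  | smul c x _ h1 => simp [h1]

theorem aux_iota_inner {B H : Type*} [CStarAlgebra B] [NormedAddCommGroup H]
    [InnerProductSpace ℂ H] [CompleteSpace H] (ι : B →⋆ₐ[ℂ] (H →L[ℂ] H)) (a b : B) (v w : H) :
    inner ℂ v (ι (star a * b) w) = inner ℂ (ι a v) (ι b w) := by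
  have h : ι (star a * b) = ContinuousLinearMap.adjoint (ι a) ∘L (ι b) := by
    rw [map_mul, map_star]
    rfl
  rw [h, ContinuousLinearMap.comp_apply, ContinuousLinearMap.adjoint_inner_right]

theorem aux_qf_star_mul {B H : Type*} [CStarAlgebra B] [NormedAddCommGroup H]
    [InnerProductSpace ℂ H] [CompleteSpace H] (ι : B →⋆ₐ[ℂ] (H →L[ℂ] H)) {n : ℕ}
    (w : Fin n → H) (z : Matrix (Fin n) (Fin n) B) :
    ∑ i, ∑ j, inner ℂ (w i) (ι ((star z * z) i j) (w j)) =
      ((∑ k, ‖∑ j, ι (z k j) (w j)‖ ^ 2 : ℝ) : ℂ) := by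
  push_cast
  have h1 : ∀ k, ((‖∑ j, ι (z k j) (w j)‖ : ℂ)) ^ 2 =
      ∑ i, ∑ j, inner ℂ (ι (z k i) (w i)) (ι (z k j) (w j)) := fun k => by
    have := inner_self_eq_norm_sq_to_K (𝕜 := ℂ) (∑ j, ι (z k j) (w j))
    rw [sum_inner] at this
    simp only [inner_sum] at this
    exact this.symm
  have h2 : ∀ i j, inner ℂ (w i) (ι ((star z * z) i j) (w j)) =
      ∑ k, inner ℂ (ι (z k i) (w i)) (ι (z k j) (w j)) := fun i j => by
    rw [Matrix.mul_apply, map_sum, sum_apply, inner_sum]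
    refine Finset.sum_congr rfl fun k _ => ?_
    rw [Matrix.star_apply, aux_iota_inner]
  simp_rw [h1, h2]
  rw [Finset.sum_comm]
  rw [Finset.sum_congr rfl fun j _ => Finset.sum_comm]
  rw [Finset.sum_comm]
  refine Finset.sum_congr rfl fun k _ => ?_
  rw [Finset.sum_comm]

open scoped ComplexOrder in
theorem aux_qf_nonneg {A B H : Type*} [CStarAlgebra A] [CStarAlgebra B] [NormedAddCommGroup H]
    [InnerProductSpace ℂ H] [CompleteSpace H] (ι : B →⋆ₐ[ℂ] (H →L[ℂ] H))
    (T : A →ₗ[ℂ] B) (hT : IsCPMap T) {n : ℕ} (w : Fin n → H)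
    (x : CStarMatrix (Fin n) (Fin n) A) :
    0 ≤ auxQf (ι.toAlgHom.toLinearMap ∘ₗ T) w (star x * x) := by
  obtain ⟨z, hz⟩ := hT n (star x * x : CStarMatrix (Fin n) (Fin n) A) ⟨x, rfl⟩
  have : auxQf (ι.toAlgHom.toLinearMap ∘ₗ T) w (star x * x) =
      ∑ i, ∑ j, inner ℂ (w i) (ι ((star z * z) i j) (w j)) := by
    rw [← hz]; rfl
  rw [this, aux_qf_star_mul]
  rw [Complex.zero_le_real]
  positivity

theorem aux_cb {A B H : Type*} [CStarAlgebra A] [PartialOrder A] [StarOrderedRing A] [CStarAlgebra B] [NormedAddCommGroup H]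
    [InnerProductSpace ℂ H] [CompleteSpace H] (ι : B →⋆ₐ[ℂ] (H →L[ℂ] H))
    (T₁ T₂ : A →ₗ[ℂ] B) (hT₁ : IsCPMap T₁) (hT₂ : IsCPMap T₂)
    (νA : ∀ n : ℕ, Matrix (Fin n) (Fin n) A → ℝ)
    (νB : ∀ n : ℕ, Matrix (Fin n) (Fin n) B → ℝ)
    (hνA : ∀ n, IsCStarNorm (νA n)) (hνB : ∀ n, IsCStarNorm (νB n))
    (α : ℝ) (hα : 0 ≤ α)
    (hcb : ∀ (n : ℕ) (x : Matrix (Fin n) (Fin n) A),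
      νB n (x.map (fun a => T₁ a - T₂ a)) ≤ α * νA n x)
    {n : ℕ} (w : Fin n → H) (x : CStarMatrix (Fin n) (Fin n) A) (hx : IsSelfAdjoint x)
    (hx1 : ‖x‖ ≤ 1) :
    (auxQf (ι.toAlgHom.toLinearMap ∘ₗ T₁) w x).re - (auxQf (ι.toAlgHom.toLinearMap ∘ₗ T₂) w x).re
      ≤ α * ∑ i, ‖w i‖ ^ 2 := by
  let _ := CStarAlgebra.spectralOrder B
  have _ := CStarAlgebra.spectralOrderedRing B
  let y : CStarMatrix (Fin n) (Fin n) B := x.map (fun a => T₁ a - T₂ a)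
  have hνA' : IsCStarNorm (R := CStarMatrix (Fin n) (Fin n) A) (νA n) :=
    ⟨(hνA n).1, (hνA n).2, (hνA n).3, (hνA n).4, (hνA n).5⟩
  have hνB' : IsCStarNorm (R := CStarMatrix (Fin n) (Fin n) B) (νB n) :=
    ⟨(hνB n).1, (hνB n).2, (hνB n).3, (hνB n).4, (hνB n).5⟩
  have hy : IsSelfAdjoint y := by
    show star y = y
    ext i j
    rw [CStarMatrix.star_apply]
    show star (T₁ (x j i) - T₂ (x j i)) = T₁ (x i j) - T₂ (x i j)
    rw [star_sub, ← aux_cp_star T₁ hT₁, ← aux_cp_star T₂ hT₂,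
      CStarMatrix.star_apply_of_isSelfAdjoint hx]
  have h1 : νA n x ≤ 1 := aux_nu_le_one _ hνA' x hx hx1
  have h2 : νB n y ≤ α := (hcb n x).trans (mul_le_of_le_one_right hα h1)
  have h3 : ∀ c, α < c → (auxQf (ι.toAlgHom.toLinearMap ∘ₗ T₁) w x).re -
      (auxQf (ι.toAlgHom.toLinearMap ∘ₗ T₂) w x).re ≤ c * ∑ i, ‖w i‖ ^ 2 := by
    intro c hc
    have h4 := sub_nonneg.2 (aux_nu_le_smul _ hνB' y hy c (h2.trans_lt hc))
    obtain ⟨z, hz⟩ := (aux_nonneg_iff _).1 h4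
    have h5 := aux_qf_star_mul ι w z
    have h6 : ∑ i, ∑ j, inner ℂ (w i) (ι ((star z * z : CStarMatrix (Fin n) (Fin n) B) i j) (w j)) =
      c * (∑ i, ‖w i‖ ^ 2 : ℝ) - ((auxQf (ι.toAlgHom.toLinearMap ∘ₗ T₁) w x) -
      (auxQf (ι.toAlgHom.toLinearMap ∘ₗ T₂) w x)) := by
      rw [← hz, auxQf_apply, auxQf_apply, Complex.ofReal_sum, Finset.mul_sum, ← Finset.sum_sub_distrib,
        ← Finset.sum_sub_distrib]
      refine Finset.sum_congr rfl fun i _ => ?_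
      rw [← Finset.sum_sub_distrib]
      have e : (c : ℂ) * ((‖w i‖ ^ 2 : ℝ) : ℂ) = ∑ j, if i = j then (c : ℂ) * inner ℂ (w i) (w j) else 0 := by
        rw [Finset.sum_ite_eq]
        simp
      rw [e, ← Finset.sum_sub_distrib]
      refine Finset.sum_congr rfl fun j _ => ?_
      rw [CStarMatrix.sub_apply, CStarMatrix.smul_apply, CStarMatrix.one_apply]
      show inner ℂ (w i) (ι (_ - (T₁ (x i j) - T₂ (x i j))) (w j)) = _ - (inner ℂ (w i) (ι (T₁ (x i j)) (w j)) - inner ℂ (w i) (ι (T₂ (x i j)) (w j)))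
      rw [map_sub, map_sub, sub_apply, sub_apply, inner_sub_right, inner_sub_right]
      congr 1
      split_ifs with h
      · rw [map_smul, map_one, smul_apply, inner_smul_right]
        rfl
      · simp
    have h7 := congrArg Complex.re (h6.symm.trans h5)
    rw [Complex.ofReal_re] at h7
    have h8 : 0 ≤ ∑ k, ‖∑ j, ι (z k j) (w j)‖ ^ 2 := by positivity
    rw [← h7, ← Complex.ofReal_mul, Complex.sub_re, Complex.sub_re, Complex.ofReal_re] at h8
    linarith
  have ht : Filter.Tendsto (fun c : ℝ => c * ∑ i, ‖w i‖ ^ 2) (nhdsWithin α (Set.Ioi α)) (nhds (α * ∑ i, ‖w i‖ ^ 2)) := by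
    apply Filter.Tendsto.mono_left _ nhdsWithin_le_nhds
    exact (continuous_id.mul continuous_const).tendsto _
  refine ge_of_tendsto ht ?_
  filter_upwards [self_mem_nhdsWithin] with c hc using h3 c hc

end

section

theorem aux_norm_le_one {M : Type*} [CStarAlgebra M] [PartialOrder M] [StarOrderedRing M] (x : M)
    (hx : IsSelfAdjoint x) (h1 : -1 ≤ x) (h2 : x ≤ 1) : ‖x‖ ≤ 1 := by
  have h2' : x ≤ algebraMap ℝ M 1 := by simpa using h2
  have h1' : algebraMap ℝ M (-1) ≤ x := by simpa using h1
  rw [le_algebraMap_iff_spectrum_le] at h2'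
  rw [algebraMap_le_iff_le_spectrum] at h1'
  rw [← cfc_id ℝ x]
  apply norm_cfc_le zero_le_one
  intro t ht
  simp only [id, Real.norm_eq_abs, abs_le]
  exact ⟨h1' t ht, h2' t ht⟩

theorem aux_sqrt_inv {M : Type*} [CStarAlgebra M] [PartialOrder M] [StarOrderedRing M] (x : M)
    (hx : 0 ≤ x) (ε : ℝ) (hε : 0 < ε) :
    ∃ t s : M, star t * t = x + (ε : ℂ) • 1 ∧ t * s = 1 ∧ s * t = 1 := by
  have h1 : (0 : M) ≤ (ε : ℂ) • (1 : M) := by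
    rw [Complex.coe_smul]; exact smul_nonneg hε.le zero_le_one
  have hu : IsUnit (x + (ε : ℂ) • (1 : M)) := by
    have h2 : (ε : ℂ) • (1 : M) ≤ x + (ε : ℂ) • 1 := le_add_of_nonneg_left hx
    refine CStarAlgebra.isUnit_of_le ((ε : ℂ) • (1 : M)) h2 ⟨h1, ?_⟩
    rw [← Algebra.algebraMap_eq_smul_one]
    exact (IsUnit.mk0 _ (by exact_mod_cast hε.ne')).map _
  have h3 : 0 ≤ x + (ε : ℂ) • (1 : M) := add_nonneg hx h1
  have h4 := CFC.sqrt_mul_sqrt_self (x + (ε : ℂ) • (1 : M)) h3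
  rw [← h4, isUnit_mul_self_iff] at hu
  obtain ⟨u, hu⟩ := hu
  refine ⟨u, (u⁻¹ : Mˣ), ?_, by simp, by simp⟩
  rw [hu, (CFC.sqrt_nonneg _).isSelfAdjoint.star_eq, h4]

theorem aux_hb0 {M : Type*} [CStarAlgebra M] [PartialOrder M] [StarOrderedRing M]
    (r : M →ₗ[ℂ] ℂ) (K : Set (M × ℝ)) (hK0 : (0, 0) ∈ K)
    (hKadd : ∀ x ∈ K, ∀ y ∈ K, x + y ∈ K) (hKsmul : ∀ c : ℝ, 0 ≤ c → ∀ x ∈ K, c • x ∈ K)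
    (hK1 : ∃ a, (1, a) ∈ K) (hKs : ∀ x ∈ K, star x.1 = x.1)
    (key : ∀ x ∈ K, ∀ u v : M, 0 ≤ u → 0 ≤ v → u + v = x.1 → (r u).re - (r v).re ≤ x.2) :
    ∃ f : M →ₗ[ℂ] ℂ, (∀ u : M, 0 ≤ u → (f u).im = 0 ∧ (r u).re ≤ (f u).re ∧ -(r u).re ≤ (f u).re)
      ∧ ∀ x ∈ K, (f x.1).re ≤ x.2 := by
  let s : PointedCone ℝ (M × ℝ) :=
    { carrier := {y | ∃ u v k : M, ∃ x ∈ K, 0 ≤ u ∧ 0 ≤ v ∧ star k = -k ∧ y.1 = u + v - x.1 + k ∧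
        x.2 - (r u).re + (r v).re ≤ y.2}
      add_mem' := by
        rintro y y' ⟨u, v, k, x, hx, hu, hv, hk, h1, h2⟩ ⟨u', v', k', x', hx', hu', hv', hk', h1', h2'⟩
        refine ⟨u + u', v + v', k + k', x + x', hKadd _ hx _ hx', add_nonneg hu hu', add_nonneg hv hv',
          ?_, ?_, ?_⟩
        · rw [star_add, hk, hk']; abel
        · rw [Prod.fst_add, Prod.fst_add, h1, h1']; abel
        · simp only [map_add, Complex.add_re, Prod.snd_add]; linarith
      zero_mem' := ⟨0, 0, 0, (0, 0), hK0, le_rfl, le_rfl, by simp, by simp, by simp⟩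
      smul_mem' := by
        rintro ⟨c, hc⟩ y ⟨u, v, k, x, hx, hu, hv, hk, h1, h2⟩
        refine ⟨c • u, c • v, c • k, c • x, hKsmul c hc x hx, smul_nonneg hc hu, smul_nonneg hc hv, ?_, ?_, ?_⟩
        · rw [star_smul, hk]; simp
        · show c • y.1 = _
          rw [h1, Prod.smul_fst]; simp only [smul_add, smul_sub]
        · show _ ≤ c • y.2
          have e : ∀ z, (r (c • z)).re = c * (r z).re := by
            intro z
            rw [← Complex.coe_smul, map_smul]; simp
          rw [e, e]
          simp only [Prod.smul_snd, smul_eq_mul]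
          nlinarith [mul_le_mul_of_nonneg_left h2 hc] }
  have hs : ∀ y, y ∈ s ↔ ∃ u v k : M, ∃ x ∈ K, 0 ≤ u ∧ 0 ≤ v ∧ star k = -k ∧ y.1 = u + v - x.1 + k ∧
        x.2 - (r u).re + (r v).re ≤ y.2 := fun y => Iff.rfl
  let f0 : (M × ℝ) →ₗ.[ℝ] ℝ :=
    { domain := Submodule.prod ⊥ ⊤
      toFun := (LinearMap.snd ℝ M ℝ) ∘ₗ (Submodule.subtype _) }
  obtain ⟨g, hg1, hg2⟩ := riesz_extension s f0 (by
    rintro ⟨⟨x, t⟩, hx⟩ h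
    obtain ⟨u, v, k, x', hx', hu, hv, hk, h1, h2⟩ := (hs _).1 h
    have hx0 : x = 0 := by
      have := hx.1
      simpa using this
    simp only [hx0] at h1 h2
    have hk2 : star k = k := by
      have e : k = x'.1 - u - v := by
        have h3 := congrArg (fun z => x'.1 - u - v + z) h1
        rw [add_zero] at h3
        rw [h3]; abel
      rw [e, star_sub, star_sub, hKs _ hx', hu.isSelfAdjoint.star_eq, hv.isSelfAdjoint.star_eq]
    have hk0 : k = 0 := by
      rw [hk2] at hk
      have : (2 : ℂ) • k = 0 := by
        rw [two_smul]; nth_rewrite 1 [hk]; simp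
      simpa using this
    rw [hk0, add_zero] at h1
    have := key x' hx' u v hu hv (sub_eq_zero.1 h1.symm)
    show 0 ≤ t
    linarith) (by
    rintro ⟨x, t⟩
    obtain ⟨a, ha⟩ := hK1
    have e1 := realPart_add_I_smul_imaginaryPart x
    set p : M := (realPart x : M)
    have hp : IsSelfAdjoint p := (realPart x).2
    have h1 := IsSelfAdjoint.neg_algebraMap_norm_le_self (a := p) hp
    rw [Algebra.algebraMap_eq_smul_one] at h1
    refine ⟨⟨(0, (‖p‖ • ((1 : M), a)).2 - (r (p + ‖p‖ • 1)).re - t), ⟨Submodule.zero_mem _, trivial⟩⟩, ?_⟩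
    rw [hs]
    refine ⟨p + ‖p‖ • 1, 0, Complex.I • (imaginaryPart x : M), ‖p‖ • (1, a), hKsmul _ (norm_nonneg _) _ ha,
      neg_le_iff_add_nonneg.1 h1, le_rfl, ?_, ?_, ?_⟩
    · rw [star_smul, (imaginaryPart x).2.star_eq]; simp
    · show 0 + x = _
      rw [zero_add]; nth_rewrite 1 [← e1]; simp
    · simp)
  let g0 : Module.Dual ℝ M := g ∘ₗ (LinearMap.inl ℝ M ℝ)
  have hg0 : ∀ x t, g (x, t) = g0 x + t := by
    intro x t
    have : (x, t) = (x, 0) + (0, t) := by simp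
    rw [this, map_add]
    congr 1
    exact hg1 ⟨(0, t), ⟨Submodule.zero_mem _, trivial⟩⟩
  have hskew : ∀ k : M, star k = -k → g0 k = 0 := by
    have h0 : ∀ k : M, star k = -k → 0 ≤ g0 k := by
      intro k hk
      have := hg2 (k, 0) ((hs _).2 ⟨0, 0, k, (0, 0), hK0, le_rfl, le_rfl, hk, by simp, by simp⟩)
      rw [hg0] at this
      simpa using this
    intro k hk
    have h1 := h0 k hk
    have h2 := h0 (-k) (by rw [star_neg, hk])
    rw [map_neg] at h2
    linarith
  refine ⟨Module.Dual.extendRCLikeₗ (𝕜 := ℂ) g0, ?_, ?_⟩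
  · intro u hu
    have e : Module.Dual.extendRCLikeₗ (𝕜 := ℂ) g0 u = (g0 u : ℂ) - Complex.I * (g0 (Complex.I • u) : ℂ) := by
      rw [Module.Dual.extendRCLikeₗ_apply]; rfl
    have e2 : g0 (Complex.I • u) = 0 := by
      apply hskew
      rw [star_smul, hu.isSelfAdjoint.star_eq]; simp
    rw [e, e2]
    have h1 := hg2 (u, -(r u).re) ((hs _).2 ⟨u, 0, 0, (0, 0), hK0, hu, le_rfl, by simp, by simp, by simp⟩)
    have h2 := hg2 (u, (r u).re) ((hs _).2 ⟨0, u, 0, (0, 0), hK0, le_rfl, hu, by simp, by simp, by simp⟩)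
    rw [hg0] at h1 h2
    refine ⟨by simp, ?_, ?_⟩ <;> simp <;> linarith
  · intro x hx
    have e : Module.Dual.extendRCLikeₗ (𝕜 := ℂ) g0 x.1 = (g0 x.1 : ℂ) - Complex.I * (g0 (Complex.I • x.1) : ℂ) := by
      rw [Module.Dual.extendRCLikeₗ_apply]; rfl
    rw [e]
    have h1 := hg2 (-x.1, x.2) ((hs _).2 ⟨0, 0, 0, x, hx, le_rfl, le_rfl, by simp, by simp, by simp⟩)
    rw [hg0, map_neg] at h1
    simp; linarith

end

section

theorem aux_smul_nonneg {M : Type*} [CStarAlgebra M] [PartialOrder M] [StarOrderedRing M] (x : M)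
    (hx : 0 ≤ x) (c : ℝ) (hc : 0 ≤ c) : 0 ≤ (c : ℂ) • x := by
  rw [Complex.coe_smul]; exact smul_nonneg hc hx

theorem aux_add_nonneg {M : Type*} [CStarAlgebra M] [PartialOrder M] [StarOrderedRing M] (x y : M)
    (hx : 0 ≤ x) (hy : 0 ≤ y) : 0 ≤ x + y := add_nonneg hx hy

/-- if `0 ≤ u, v` and `u + v = p ≤ t* t` with `t` invertible, then `u - v` is `t* x t`
for a self-adjoint contraction `x` -/
theorem aux_compress {M : Type*} [CStarAlgebra M] [PartialOrder M] [StarOrderedRing M]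
    (u v t s d : M) (hu : 0 ≤ u) (hv : 0 ≤ v) (hd : 0 ≤ d) (h : u + v + d = star t * t)
    (hts : t * s = 1) (hst : s * t = 1) :
    ∃ x : M, IsSelfAdjoint x ∧ ‖x‖ ≤ 1 ∧ u - v = star t * x * t := by
  have hts' : star s * star t = 1 := by rw [← star_mul, hts, star_one]
  have hst' : star t * star s = 1 := by rw [← star_mul, hst, star_one]
  have h1 := star_left_conjugate_nonneg hu s
  have h2 := star_left_conjugate_nonneg hv s
  have h3 := star_left_conjugate_nonneg hd s
  have h4 : star s * u * s + star s * v * s + star s * d * s = 1 := by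
    have : star s * u * s + star s * v * s + star s * d * s = star s * (u + v + d) * s := by
      noncomm_ring
    rw [this, h]
    calc star s * (star t * t) * s = (star s * star t) * (t * s) := by noncomm_ring
      _ = 1 := by rw [hts, hts', one_mul]
  refine ⟨star s * u * s - star s * v * s, ?_, ?_, ?_⟩
  · exact h1.isSelfAdjoint.sub h2.isSelfAdjoint
  · apply aux_norm_le_one
    · exact h1.isSelfAdjoint.sub h2.isSelfAdjoint
    · rw [← h4, ← sub_nonneg]
      have e : star s * u * s - star s * v * s - -(star s * u * s + star s * v * s + star s * d * s)
        = star s * u * s + star s * u * s + star s * d * s := by abel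
      rw [e]
      exact add_nonneg (add_nonneg h1 h1) h3
    · rw [← h4, ← sub_nonneg]
      have e : (star s * u * s + star s * v * s + star s * d * s) - (star s * u * s - star s * v * s)
        = star s * v * s + star s * v * s + star s * d * s := by abel
      rw [e]
      exact add_nonneg (add_nonneg h2 h2) h3
  · have : star t * (star s * u * s - star s * v * s) * t
      = (star t * star s) * (u - v) * (s * t) := by noncomm_ring
    rw [this, hst, hst', one_mul, mul_one]

/-- scalar matrices inside matrices over `A` -/
noncomputable def auxJ (A : Type*) [CStarAlgebra A] {n : ℕ} (t : CStarMatrix (Fin n) (Fin n) ℂ) :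
    CStarMatrix (Fin n) (Fin n) A :=
  CStarMatrix.ofMatrix (Matrix.of fun i j => t i j • (1 : A))

theorem auxJ_apply (A : Type*) [CStarAlgebra A] {n : ℕ} (t : CStarMatrix (Fin n) (Fin n) ℂ)
    (i j : Fin n) : auxJ A t i j = t i j • (1 : A) := rfl

theorem auxJ_add (A : Type*) [CStarAlgebra A] {n : ℕ} (t s : CStarMatrix (Fin n) (Fin n) ℂ) :
    auxJ A (t + s) = auxJ A t + auxJ A s := by
  ext i j; simp [auxJ_apply, add_smul]

theorem auxJ_smul (A : Type*) [CStarAlgebra A] {n : ℕ} (c : ℂ) (t : CStarMatrix (Fin n) (Fin n) ℂ) :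
    auxJ A (c • t) = c • auxJ A t := by
  ext i j; simp [auxJ_apply, smul_smul]

theorem auxJ_zero (A : Type*) [CStarAlgebra A] {n : ℕ} :
    auxJ A (0 : CStarMatrix (Fin n) (Fin n) ℂ) = 0 := by
  ext i j; simp [auxJ_apply]

theorem auxJ_one (A : Type*) [CStarAlgebra A] {n : ℕ} :
    auxJ A (1 : CStarMatrix (Fin n) (Fin n) ℂ) = 1 := by
  ext i j
  rw [auxJ_apply, CStarMatrix.one_apply, CStarMatrix.one_apply]
  split_ifs <;> simp

theorem auxJ_star (A : Type*) [CStarAlgebra A] {n : ℕ} (t : CStarMatrix (Fin n) (Fin n) ℂ) :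
    auxJ A (star t) = star (auxJ A t) := by
  ext i j
  simp [auxJ_apply, CStarMatrix.star_apply]

theorem auxJ_mul (A : Type*) [CStarAlgebra A] {n : ℕ} (t s : CStarMatrix (Fin n) (Fin n) ℂ) :
    auxJ A (t * s) = auxJ A t * auxJ A s := by
  ext i j
  simp only [auxJ_apply, CStarMatrix.mul_apply, Finset.sum_smul, smul_mul_smul_comm, mul_one]

theorem auxQf_conj {A H : Type*} [CStarAlgebra A] [NormedAddCommGroup H] [InnerProductSpace ℂ H]
    (S : A →ₗ[ℂ] (H →L[ℂ] H)) {n : ℕ} (e : Fin n → H) (t : CStarMatrix (Fin n) (Fin n) ℂ)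
    (x : CStarMatrix (Fin n) (Fin n) A) :
    auxQf S e (star (auxJ A t) * x * auxJ A t) = auxQf S (fun k => ∑ i, t k i • e i) x := by
  have h1 : ∀ i j, (star (auxJ A t) * x * auxJ A t) i j =
      ∑ l, ∑ k, (t l j * star (t k i)) • x k l := by
    intro i j
    simp only [CStarMatrix.mul_apply, CStarMatrix.star_apply, auxJ_apply, star_smul, star_one,
      smul_mul_assoc, one_mul, mul_smul_comm, mul_one, Finset.smul_sum, smul_smul]
  have h2 : ∀ k l, inner ℂ (∑ i, t k i • e i) (S (x k l) (∑ j, t l j • e j)) =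
      ∑ i, ∑ j, (t l j * star (t k i)) * inner ℂ (e i) (S (x k l) (e j)) := by
    intro k l
    rw [sum_inner]
    refine Finset.sum_congr rfl fun i _ => ?_
    rw [map_sum, inner_sum]
    refine Finset.sum_congr rfl fun j _ => ?_
    rw [map_smul, inner_smul_left, inner_smul_right, starRingEnd_apply]
    ring
  rw [auxQf_apply, auxQf_apply]
  simp_rw [h1, h2]
  simp only [map_sum, map_smul, sum_apply, smul_apply, inner_sum, inner_smul_right]
  rw [Finset.sum_congr rfl fun i _ => Finset.sum_congr rfl fun j _ => Finset.sum_comm]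
  rw [Finset.sum_congr rfl fun i _ => Finset.sum_comm]
  rw [Finset.sum_comm]
  refine Finset.sum_congr rfl fun k _ => ?_
  rw [Finset.sum_congr rfl fun i _ => Finset.sum_comm]
  rw [Finset.sum_comm]

/-- trace -/
noncomputable def auxTr {n : ℕ} (t : CStarMatrix (Fin n) (Fin n) ℂ) : ℝ := ∑ i, (t i i).re

theorem auxTr_star_mul {n : ℕ} (t : CStarMatrix (Fin n) (Fin n) ℂ) :
    auxTr (star t * t) = ∑ k, ∑ i, ‖t k i‖ ^ 2 := by
  rw [Finset.sum_comm]
  refine Finset.sum_congr rfl fun i _ => ?_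
  rw [CStarMatrix.mul_apply, Complex.re_sum]
  refine Finset.sum_congr rfl fun k _ => ?_
  rw [CStarMatrix.star_apply, Complex.star_def, ← Complex.normSq_eq_conj_mul_self, Complex.ofReal_re,
    Complex.normSq_eq_norm_sq]

theorem aux_orth_norm {H : Type*} [NormedAddCommGroup H] [InnerProductSpace ℂ H] {n : ℕ}
    (e : Fin n → H) (he : Orthonormal ℂ e) (c : Fin n → ℂ) :
    ‖∑ i, c i • e i‖ ^ 2 = ∑ i, ‖c i‖ ^ 2 := by
  have h := inner_self_eq_norm_sq_to_K (𝕜 := ℂ) (∑ i, c i • e i)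
  rw [he.inner_sum] at h
  have h2 := congrArg Complex.re h
  simp only [Complex.re_sum, ← Complex.normSq_eq_conj_mul_self] at h2
  simp only [Complex.normSq_eq_norm_sq, Complex.ofReal_re] at h2
  rw [h2]
  norm_cast

end

section

open scoped ComplexOrder in
theorem aux_hb_key {A H : Type*} [CStarAlgebra A] [PartialOrder A] [StarOrderedRing A]
    [NormedAddCommGroup H] [InnerProductSpace ℂ H]
    (S₁ S₂ : A →ₗ[ℂ] (H →L[ℂ] H)) (α : ℝ)
    (hcb : ∀ {n : ℕ} (w : Fin n → H) (x : CStarMatrix (Fin n) (Fin n) A), IsSelfAdjoint x →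
      ‖x‖ ≤ 1 → (auxQf S₁ w x).re - (auxQf S₂ w x).re ≤ α * ∑ i, ‖w i‖ ^ 2)
    {n : ℕ} (e : Fin n → H) (he : Orthonormal ℂ e)
    (ρ : CStarMatrix (Fin n) (Fin n) ℂ) (hρ : 0 ≤ ρ)
    (u v : CStarMatrix (Fin n) (Fin n) A) (hu : 0 ≤ u) (hv : 0 ≤ v) (huv : u + v = auxJ A ρ) :
    ((auxQf S₁ e - auxQf S₂ e) u).re - ((auxQf S₁ e - auxQf S₂ e) v).re ≤ α * auxTr ρ := by
  have h3 : ∀ ε : ℝ, 0 < ε → ((auxQf S₁ e - auxQf S₂ e) u).re - ((auxQf S₁ e - auxQf S₂ e) v).re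
      ≤ α * (auxTr ρ + n * ε) := by
    intro ε hε
    obtain ⟨t, s, h1, h2, h3⟩ := aux_sqrt_inv ρ hρ ε hε
    obtain ⟨x, hx, hx1, hx2⟩ := aux_compress u v (auxJ A t) (auxJ A s) ((ε : ℂ) • 1) hu hv
      (aux_smul_nonneg _ ((aux_nonneg_iff _).2 ⟨1, by rw [star_one, one_mul]⟩) ε hε.le)
      (by rw [huv, ← auxJ_star, ← auxJ_mul, h1, auxJ_add, auxJ_smul, auxJ_one])
      (by rw [← auxJ_mul, h2, auxJ_one]) (by rw [← auxJ_mul, h3, auxJ_one])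
    have h4 := hcb (fun k => ∑ i, t k i • e i) x hx hx1
    rw [← auxQf_conj, ← auxQf_conj, ← hx2] at h4
    simp only [aux_orth_norm e he] at h4
    rw [← auxTr_star_mul, h1] at h4
    have h5 : auxTr (ρ + (ε : ℂ) • 1) = auxTr ρ + n * ε := by
      simp only [auxTr, CStarMatrix.add_apply, Complex.add_re, Finset.sum_add_distrib]
      congr 1
      have : ∀ i : Fin n, (((ε : ℂ) • (1 : CStarMatrix (Fin n) (Fin n) ℂ)) i i).re = ε := by
        intro i
        rw [CStarMatrix.smul_apply, CStarMatrix.one_apply_eq]; simp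
      simp [this]
    rw [h5] at h4
    refine le_trans (le_of_eq ?_) h4
    rw [map_sub, map_sub]
    simp only [LinearMap.sub_apply, Complex.sub_re]
    ring
  have ht : Filter.Tendsto (fun ε : ℝ => α * (auxTr ρ + n * ε)) (nhdsWithin 0 (Set.Ioi 0))
      (nhds (α * (auxTr ρ + n * 0))) := by
    apply Filter.Tendsto.mono_left _ nhdsWithin_le_nhds
    apply Continuous.tendsto
    fun_prop
  have := ge_of_tendsto ht (by
    filter_upwards [self_mem_nhdsWithin] with c hc using h3 c hc)
  simpa using this

open scoped ComplexOrder in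
theorem aux_hb {A H : Type*} [CStarAlgebra A] [PartialOrder A] [StarOrderedRing A]
    [NormedAddCommGroup H] [InnerProductSpace ℂ H]
    (S₁ S₂ : A →ₗ[ℂ] (H →L[ℂ] H)) (α : ℝ)
    (hS₁ : ∀ {n : ℕ} (w : Fin n → H) (x : CStarMatrix (Fin n) (Fin n) A),
      0 ≤ auxQf S₁ w (star x * x))
    (hS₂ : ∀ {n : ℕ} (w : Fin n → H) (x : CStarMatrix (Fin n) (Fin n) A),
      0 ≤ auxQf S₂ w (star x * x))
    (hcb : ∀ {n : ℕ} (w : Fin n → H) (x : CStarMatrix (Fin n) (Fin n) A), IsSelfAdjoint x →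
      ‖x‖ ≤ 1 → (auxQf S₁ w x).re - (auxQf S₂ w x).re ≤ α * ∑ i, ‖w i‖ ^ 2)
    {n : ℕ} (e : Fin n → H) (he : Orthonormal ℂ e) :
    ∃ f : CStarMatrix (Fin n) (Fin n) A →ₗ[ℂ] ℂ,
      (∀ x, auxQf S₁ e (star x * x) - auxQf S₂ e (star x * x) ≤ f (star x * x)) ∧
      (∀ x, auxQf S₂ e (star x * x) - auxQf S₁ e (star x * x) ≤ f (star x * x)) ∧
      ∀ t : CStarMatrix (Fin n) (Fin n) ℂ,
        (f (star (auxJ A t) * auxJ A t)).re ≤ α * ∑ k, ∑ i, ‖t k i‖ ^ 2 := by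
  obtain ⟨f, hf1, hf2⟩ := aux_hb0 (auxQf S₁ e - auxQf S₂ e)
    {y | ∃ ρ : CStarMatrix (Fin n) (Fin n) ℂ, 0 ≤ ρ ∧ y = (auxJ A ρ, α * auxTr ρ)}
    ⟨0, le_rfl, by rw [auxJ_zero]; simp [auxTr]⟩
    (by
      rintro _ ⟨ρ, h, rfl⟩ _ ⟨σ, h', rfl⟩
      refine ⟨ρ + σ, aux_add_nonneg _ _ h h', ?_⟩
      rw [auxJ_add]
      simp [auxTr, Finset.sum_add_distrib, mul_add])
    (by
      rintro c hc _ ⟨ρ, h, rfl⟩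
      refine ⟨(c : ℂ) • ρ, aux_smul_nonneg _ h c hc, ?_⟩
      rw [auxJ_smul]
      ext1
      · exact (Complex.coe_smul c _).symm
      · simp [auxTr, Finset.mul_sum]
        refine Finset.sum_congr rfl fun i _ => ?_
        ring)
    ⟨α * auxTr (1 : CStarMatrix (Fin n) (Fin n) ℂ), 1,
      (aux_nonneg_iff _).2 ⟨1, by rw [star_one, one_mul]⟩, by rw [auxJ_one]⟩
    (by
      rintro _ ⟨ρ, h, rfl⟩
      obtain ⟨t, rfl⟩ := (aux_nonneg_iff ρ).1 h
      show star (auxJ A (star t * t)) = auxJ A (star t * t)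
      rw [← auxJ_star, star_mul, star_star])
    (by
      rintro _ ⟨ρ, h, rfl⟩ u v hu hv huv
      exact aux_hb_key S₁ S₂ α hcb e he ρ h u v hu hv huv)
  have him : ∀ x, ((auxQf S₁ e - auxQf S₂ e) (star x * x)).im = 0 := by
    intro x
    have h1 := (Complex.le_def.1 (hS₁ e x)).2
    have h2 := (Complex.le_def.1 (hS₂ e x)).2
    simp only [LinearMap.sub_apply, Complex.sub_im, ← h1, ← h2]
    simp
  refine ⟨f, ?_, ?_, ?_⟩
  · intro x
    obtain ⟨h1, h2, h3⟩ := hf1 (star x * x) ((aux_nonneg_iff _).2 ⟨x, rfl⟩)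
    rw [← LinearMap.sub_apply, Complex.le_def]
    exact ⟨h2, by rw [h1, him]⟩
  · intro x
    obtain ⟨h1, h2, h3⟩ := hf1 (star x * x) ((aux_nonneg_iff _).2 ⟨x, rfl⟩)
    rw [← neg_sub, ← LinearMap.sub_apply, Complex.le_def]
    exact ⟨by rw [Complex.neg_re]; exact h3, by rw [h1, Complex.neg_im, him, neg_zero]⟩
  · intro t
    have := hf2 (auxJ A (star t * t), α * auxTr (star t * t)) ⟨_, (aux_nonneg_iff _).2 ⟨t, rfl⟩, rfl⟩
    rw [auxTr_star_mul] at this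
    rw [← auxJ_star, ← auxJ_mul]
    exact this

end

section

/-- trilinearity -/
structure AuxTri {A H : Type*} [CStarAlgebra A] [NormedAddCommGroup H] [InnerProductSpace ℂ H]
    (φ : A → H → H → ℂ) : Prop where
  addA : ∀ a b ξ η, φ (a + b) ξ η = φ a ξ η + φ b ξ η
  smulA : ∀ (c : ℂ) a ξ η, φ (c • a) ξ η = c * φ a ξ η
  addL : ∀ a ξ ξ' η, φ a (ξ + ξ') η = φ a ξ η + φ a ξ' η
  smulL : ∀ (c : ℂ) a ξ η, φ a (c • ξ) η = star c * φ a ξ η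
  addR : ∀ a ξ η η', φ a ξ (η + η') = φ a ξ η + φ a ξ η'
  smulR : ∀ (c : ℂ) a ξ η, φ a ξ (c • η) = c * φ a ξ η

/-- positivity of the block form on a family -/
def AuxPos {A H : Type*} [CStarAlgebra A] [NormedAddCommGroup H] [InnerProductSpace ℂ H]
    (S₁ S₂ : A →ₗ[ℂ] (H →L[ℂ] H)) (φ : A → H → H → ℂ) {m : ℕ} (a : Fin m → A)
    (v w : Fin m → H) : Prop :=
  0 ≤ (∑ k, ∑ l, inner ℂ (v k) (S₁ (star (a k) * a l) (v l)) : ℂ).re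
    + 2 * (∑ k, ∑ l, φ (star (a k) * a l) (v k) (w l)).re
    + (∑ k, ∑ l, inner ℂ (w k) (S₂ (star (a k) * a l) (w l)) : ℂ).re

/-- the bound on the diagonal -/
def AuxBd {A H : Type*} [CStarAlgebra A] [NormedAddCommGroup H] [InnerProductSpace ℂ H]
    (S₁ S₂ : A →ₗ[ℂ] (H →L[ℂ] H)) (α : ℝ) (φ : A → H → H → ℂ) (ξ : H) : Prop :=
  (inner ℂ ξ (S₁ 1 ξ) : ℂ).re + (inner ℂ ξ (S₂ 1 ξ) : ℂ).re - 2 * (φ 1 ξ ξ).re ≤ α * ‖ξ‖ ^ 2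

/-- auxiliary matrix -/
noncomputable def auxX {A H : Type*} [CStarAlgebra A] [NormedAddCommGroup H]
    [InnerProductSpace ℂ H] {n : ℕ} (e : Fin n → H) (a : A) (ξ η : H) :
    CStarMatrix (Fin n) (Fin n) A :=
  CStarMatrix.ofMatrix (Matrix.of fun i j => (inner ℂ ξ (e i) * inner ℂ (e j) η : ℂ) • a)

theorem auxX_apply {A H : Type*} [CStarAlgebra A] [NormedAddCommGroup H]
    [InnerProductSpace ℂ H] {n : ℕ} (e : Fin n → H) (a : A) (ξ η : H) (i j : Fin n) :
    auxX e a ξ η i j = (inner ℂ ξ (e i) * inner ℂ (e j) η : ℂ) • a := rfl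

theorem auxX_tri {A H : Type*} [CStarAlgebra A] [NormedAddCommGroup H]
    [InnerProductSpace ℂ H] {n : ℕ} (e : Fin n → H) (c : CStarMatrix (Fin n) (Fin n) A →ₗ[ℂ] ℂ) :
    AuxTri (fun a ξ η => c (auxX e a ξ η)) where
  addA a b ξ η := by
    rw [← map_add]; congr 1
    ext i j; simp [auxX_apply]
  smulA r a ξ η := by
    rw [← smul_eq_mul, ← map_smul]; congr 1
    ext i j; simp only [auxX_apply, CStarMatrix.smul_apply, smul_smul]; congr 1; ring
  addL a ξ ξ' η := by
    rw [← map_add]; congr 1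
    ext i j; simp [auxX_apply, inner_add_left, add_mul, add_smul]
  smulL r a ξ η := by
    rw [← smul_eq_mul, ← map_smul]; congr 1
    ext i j
    simp only [auxX_apply, CStarMatrix.smul_apply, smul_smul, inner_smul_left, starRingEnd_apply]
    congr 1; ring
  addR a ξ η η' := by
    rw [← map_add]; congr 1
    ext i j; simp [auxX_apply, inner_add_right, mul_add, add_smul]
  smulR r a ξ η := by
    rw [← smul_eq_mul, ← map_smul]; congr 1
    ext i j
    simp only [auxX_apply, CStarMatrix.smul_apply, smul_smul, inner_smul_right]
    congr 1; ring

theorem auxX_qf {A H : Type*} [CStarAlgebra A] [NormedAddCommGroup H]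
    [InnerProductSpace ℂ H] (S : A →ₗ[ℂ] (H →L[ℂ] H)) {n : ℕ} (e : Fin n → H) (a : A) (ξ η : H)
    (hξ : ∑ i, (inner ℂ (e i) ξ : ℂ) • e i = ξ) (hη : ∑ i, (inner ℂ (e i) η : ℂ) • e i = η) :
    auxQf S e (auxX e a ξ η) = inner ℂ ξ (S a η) := by
  rw [auxQf_apply]
  conv_rhs => rw [← hξ, ← hη]
  rw [sum_inner]
  refine Finset.sum_congr rfl fun i _ => ?_
  rw [map_sum, inner_sum]
  refine Finset.sum_congr rfl fun j _ => ?_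
  rw [auxX_apply, map_smul, smul_apply, map_smul, inner_smul_right, inner_smul_left,
    inner_smul_right, inner_conj_symm]
  ring

/-- row matrix -/
noncomputable def auxRow {A H : Type*} [CStarAlgebra A] [NormedAddCommGroup H]
    [InnerProductSpace ℂ H] {n m : ℕ} (e : Fin n → H) (p : Fin n) (a : Fin m → A) (w : Fin m → H) :
    CStarMatrix (Fin n) (Fin n) A :=
  CStarMatrix.ofMatrix (Matrix.of fun i j => if i = p then ∑ k, (inner ℂ (e j) (w k) : ℂ) • a k else 0)

theorem auxRow_apply {A H : Type*} [CStarAlgebra A] [NormedAddCommGroup H]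
    [InnerProductSpace ℂ H] {n m : ℕ} (e : Fin n → H) (p : Fin n) (a : Fin m → A) (w : Fin m → H)
    (i j : Fin n) :
    auxRow e p a w i j = if i = p then ∑ k, (inner ℂ (e j) (w k) : ℂ) • a k else 0 := rfl

theorem auxRow_mul {A H : Type*} [CStarAlgebra A] [NormedAddCommGroup H]
    [InnerProductSpace ℂ H] {n m : ℕ} (e : Fin n → H) (p : Fin n) (a : Fin m → A) (v w : Fin m → H) :
    star (auxRow e p a v) * auxRow e p a w =
      ∑ k, ∑ l, auxX e (star (a k) * a l) (v k) (w l) := by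
  have hs : ∀ (g : Fin m → CStarMatrix (Fin n) (Fin n) A) i j, (∑ k, g k) i j = ∑ k, g k i j := by
    intro g i j
    exact Matrix.sum_apply i j _ g
  ext i j
  rw [CStarMatrix.mul_apply, hs]
  simp only [hs, CStarMatrix.star_apply, auxRow_apply, auxX_apply]
  rw [Finset.sum_eq_single p (by intro b _ hb; simp [hb]) (by simp)]
  simp only [if_true, star_sum, star_smul, Finset.sum_mul, Finset.mul_sum, smul_mul_smul_comm]
  rw [Finset.sum_comm]
  refine Finset.sum_congr rfl fun k _ => Finset.sum_congr rfl fun l _ => ?_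
  rw [Complex.star_def, inner_conj_symm]

open scoped ComplexOrder in
theorem aux_fin {A H : Type*} [CStarAlgebra A] [PartialOrder A] [StarOrderedRing A]
    [NormedAddCommGroup H] [InnerProductSpace ℂ H]
    (S₁ S₂ : A →ₗ[ℂ] (H →L[ℂ] H)) (α : ℝ)
    (hS₁ : ∀ {n : ℕ} (w : Fin n → H) (x : CStarMatrix (Fin n) (Fin n) A),
      0 ≤ auxQf S₁ w (star x * x))
    (hS₂ : ∀ {n : ℕ} (w : Fin n → H) (x : CStarMatrix (Fin n) (Fin n) A),
      0 ≤ auxQf S₂ w (star x * x))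
    (hcb : ∀ {n : ℕ} (w : Fin n → H) (x : CStarMatrix (Fin n) (Fin n) A), IsSelfAdjoint x →
      ‖x‖ ≤ 1 → (auxQf S₁ w x).re - (auxQf S₂ w x).re ≤ α * ∑ i, ‖w i‖ ^ 2)
    (F : Submodule ℂ H) [FiniteDimensional ℂ F] :
    ∃ φ : A → H → H → ℂ, AuxTri φ ∧
      (∀ {m : ℕ} (a : Fin m → A) (v w : Fin m → H), (∀ k, v k ∈ F) → (∀ k, w k ∈ F) →
        AuxPos S₁ S₂ φ a v w) ∧ ∀ ξ ∈ F, AuxBd S₁ S₂ α φ ξ := by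
  obtain ⟨n, e, he, hF⟩ : ∃ (n : ℕ) (e : Fin n → H), Orthonormal ℂ e ∧
      ∀ ξ ∈ F, ∑ i, (inner ℂ (e i) ξ : ℂ) • e i = ξ := by
    let b := stdOrthonormalBasis ℂ F
    refine ⟨_, fun i => (b i : H), ?_, ?_⟩
    · exact b.orthonormal.comp_linearIsometry F.subtypeₗᵢ
    · intro ξ hξ
      have := congrArg (Subtype.val) (b.sum_repr' ⟨ξ, hξ⟩)
      simpa using this
  obtain ⟨f, hf1, hf2, hf3⟩ := aux_hb S₁ S₂ α hS₁ hS₂ hcb e he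
  obtain ⟨c, hc1, hc2⟩ := aux_gns (auxQf S₁ e) (auxQf S₂ e) f (hS₁ e) (hS₂ e) hf1 hf2
  refine ⟨fun a ξ η => c (auxX e a ξ η), auxX_tri e c, ?_, ?_⟩
  · intro m a v w hv hw
    unfold AuxPos
    rcases isEmpty_or_nonempty (Fin n) with h0 | ⟨⟨p⟩⟩
    · have hv0 : ∀ k, v k = 0 := fun k => by rw [← hF _ (hv k)]; simp
      have hw0 : ∀ k, w k = 0 := fun k => by rw [← hF _ (hw k)]; simp
      have hX : ∀ (a : A) ξ η, auxX e a ξ η = 0 := by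
        intro a ξ η; ext i; exact (h0.false i).elim
      simp [hv0, hw0, hX]
    · have := hc1 (auxRow e p a v) (auxRow e p a w)
      rw [auxRow_mul, auxRow_mul, auxRow_mul] at this
      simp only [map_sum] at this ⊢
      simp only [auxX_qf S₁ e _ _ _ (hF _ (hv _)) (hF _ (hv _)),
        auxX_qf S₂ e _ _ _ (hF _ (hw _)) (hF _ (hw _))] at this
      simpa using this
  · intro ξ hξ
    unfold AuxBd
    rcases isEmpty_or_nonempty (Fin n) with h0 | ⟨⟨p⟩⟩
    · have hv0 : ξ = 0 := by rw [← hF _ hξ]; simp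
      have hX : ∀ (a : A) ξ η, auxX e a ξ η = 0 := by
        intro a ξ η; ext i; exact (h0.false i).elim
      simp [hv0, hX]
    · let t : CStarMatrix (Fin n) (Fin n) ℂ :=
        CStarMatrix.ofMatrix (Matrix.of fun i j => if i = p then (inner ℂ (e j) ξ : ℂ) else 0)
      have ht : ∀ i j, t i j = if i = p then (inner ℂ (e j) ξ : ℂ) else 0 := fun _ _ => rfl
      have h1 : star (auxJ A t) * auxJ A t = auxX e 1 ξ ξ := by
        ext i j
        rw [← auxJ_star, ← auxJ_mul, auxJ_apply, auxX_apply, CStarMatrix.mul_apply]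
        simp only [CStarMatrix.star_apply, ht]
        rw [Finset.sum_eq_single p (by intro b _ hb; simp [hb]) (by simp)]
        rw [if_pos rfl, if_pos rfl, Complex.star_def, inner_conj_symm]
      have h2 := (hc2 (auxJ A t)).trans (hf3 t)
      rw [h1, auxX_qf S₁ e _ _ _ (hF _ hξ) (hF _ hξ), auxX_qf S₂ e _ _ _ (hF _ hξ) (hF _ hξ)] at h2
      have h3 : ∑ k, ∑ i, ‖t k i‖ ^ 2 = ‖ξ‖ ^ 2 := by
        rw [← hF ξ hξ, aux_orth_norm e he]
        rw [Finset.sum_eq_single p (by intro b _ hb; simp [ht, hb]) (by simp)]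
        simp [ht]
      rw [h3] at h2
      exact h2

end

section

theorem aux_bound {A H : Type*} [CStarAlgebra A] [NormedAddCommGroup H] [InnerProductSpace ℂ H]
    (S₁ S₂ : A →ₗ[ℂ] (H →L[ℂ] H)) (φ : A → H → H → ℂ) (hφ : AuxTri φ) (F : Submodule ℂ H)
    (hp : ∀ {m : ℕ} (a : Fin m → A) (v w : Fin m → H), (∀ k, v k ∈ F) → (∀ k, w k ∈ F) →
        AuxPos S₁ S₂ φ a v w) (a : A) (ξ η : H) (hξ : ξ ∈ F) (hη : η ∈ F) :
    ‖φ a ξ η‖ ≤ (‖S₁ 1‖ + ‖S₂ (star a * a)‖) * ‖ξ‖ * ‖η‖ := by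
  have hL0 : ∀ a η, φ a 0 η = 0 := by
    intro a η; have := hφ.smulL 0 a 0 η; simpa using this
  have hR0 : ∀ a ξ, φ a ξ 0 = 0 := by
    intro a ξ; have := hφ.smulR 0 a ξ 0; simpa using this
  have hn : ∀ (T : H →L[ℂ] H) (x : H), (inner ℂ x (T x) : ℂ).re ≤ ‖T‖ * ‖x‖ ^ 2 := by
    intro T x
    calc (inner ℂ x (T x) : ℂ).re ≤ ‖(inner ℂ x (T x) : ℂ)‖ := Complex.re_le_norm _
      _ ≤ ‖x‖ * ‖T x‖ := norm_inner_le_norm _ _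
      _ ≤ ‖x‖ * (‖T‖ * ‖x‖) := by gcongr; exact T.le_opNorm x
      _ = _ := by ring
  have h1 : ∀ ξ ∈ F, ∀ η ∈ F, -(2 * (φ a ξ η).re) ≤ ‖S₁ 1‖ * ‖ξ‖ ^ 2 + ‖S₂ (star a * a)‖ * ‖η‖ ^ 2 := by
    intro ξ hξ η hη
    have := hp ![1, a] ![ξ, 0] ![0, η] (by intro k; fin_cases k <;> simp [hξ])
      (by intro k; fin_cases k <;> simp [hη])
    simp [AuxPos, hL0, hR0] at this
    have h2 := hn (S₁ 1) ξ
    have h3 := hn (S₂ (star a * a)) η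
    linarith
  have h2 : ∀ ξ ∈ F, ∀ η ∈ F, 2 * ‖φ a ξ η‖ ≤ ‖S₁ 1‖ * ‖ξ‖ ^ 2 + ‖S₂ (star a * a)‖ * ‖η‖ ^ 2 := by
    intro ξ hξ η hη
    by_cases h0 : φ a ξ η = 0
    · rw [h0]; simp; positivity
    set p := φ a ξ η with hpdef
    have hp0 : ‖p‖ ≠ 0 := norm_ne_zero_iff.2 h0
    have := h1 ((-p / ‖p‖ : ℂ) • ξ) (F.smul_mem _ hξ) η hη
    rw [hφ.smulL, norm_smul, ← hpdef] at this
    have e1 : ‖(-p / ‖p‖ : ℂ)‖ = 1 := by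
      simp [hp0]
    have e2 : star (-p / ‖p‖ : ℂ) * p = ((-‖p‖ : ℝ) : ℂ) := by
      have hp0' : (‖p‖ : ℂ) ≠ 0 := by exact_mod_cast hp0
      have e3 : star p * p = (‖p‖ : ℂ) ^ 2 := by
        rw [Complex.star_def, Complex.conj_mul']
      rw [star_div₀, star_neg]
      have : star (‖p‖ : ℂ) = ‖p‖ := Complex.conj_ofReal _
      rw [this, div_mul_eq_mul_div, neg_mul, e3]
      push_cast
      field_simp
    rw [e1, e2, Complex.ofReal_re, one_mul] at this
    linarith
  by_cases hξ0 : ξ = 0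
  · simp [hξ0, hL0]
  by_cases hη0 : η = 0
  · simp [hη0, hR0]
  have a1 : 0 < ‖ξ‖ := norm_pos_iff.2 hξ0
  have a2 : 0 < ‖η‖ := norm_pos_iff.2 hη0
  have h3 := h2 (((‖ξ‖⁻¹ : ℝ) : ℂ) • ξ) (F.smul_mem _ hξ) (((‖η‖⁻¹ : ℝ) : ℂ) • η) (F.smul_mem _ hη)
  rw [hφ.smulL, hφ.smulR, norm_smul, norm_smul, norm_mul, norm_mul, norm_star,
    Complex.norm_real, Complex.norm_real, norm_inv, norm_inv, norm_norm, norm_norm,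
    inv_mul_cancel₀ a1.ne', inv_mul_cancel₀ a2.ne'] at h3
  have h4 : ‖φ a ξ η‖ = (‖ξ‖⁻¹ * (‖η‖⁻¹ * ‖φ a ξ η‖)) * ‖ξ‖ * ‖η‖ := by field_simp
  rw [h4]
  gcongr
  have b1 := norm_nonneg (S₁ 1)
  have b2 := norm_nonneg (S₂ (star a * a))
  linarith

open scoped ComplexOrder in
theorem aux_lim {A H : Type*} [CStarAlgebra A] [PartialOrder A] [StarOrderedRing A]
    [NormedAddCommGroup H] [InnerProductSpace ℂ H]
    (S₁ S₂ : A →ₗ[ℂ] (H →L[ℂ] H)) (α : ℝ)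
    (hfin : ∀ s : Finset H, ∃ φ : A → H → H → ℂ, AuxTri φ ∧
      (∀ {m : ℕ} (a : Fin m → A) (v w : Fin m → H), (∀ k, v k ∈ Submodule.span ℂ (s : Set H)) →
        (∀ k, w k ∈ Submodule.span ℂ (s : Set H)) →
        AuxPos S₁ S₂ φ a v w) ∧ ∀ ξ ∈ Submodule.span ℂ (s : Set H), AuxBd S₁ S₂ α φ ξ) :
    ∃ φ : A → H → H → ℂ, AuxTri φ ∧
      (∀ {m : ℕ} (a : Fin m → A) (v w : Fin m → H), AuxPos S₁ S₂ φ a v w) ∧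
      ∀ ξ, AuxBd S₁ S₂ α φ ξ := by
  choose φ hT hP hB using hfin
  let U : Ultrafilter (Finset H) := Ultrafilter.of Filter.atTop
  have hU : (U : Filter (Finset H)) ≤ Filter.atTop := Ultrafilter.of_le _
  have hev : ∀ ξ : H, ∀ᶠ s in (U : Filter (Finset H)), ξ ∈ Submodule.span ℂ ((s : Finset H) : Set H) := by
    intro ξ
    refine hU ?_
    filter_upwards [Filter.eventually_ge_atTop ({ξ} : Finset H)] with s hs
    exact Submodule.subset_span (hs (Finset.mem_singleton_self ξ))
  have hlim : ∀ a ξ η, ∃ z, Filter.Tendsto (fun s => φ s a ξ η) U (nhds z) := by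
    intro a ξ η
    obtain ⟨z, _, hz⟩ := (isCompact_closedBall (0 : ℂ)
      ((‖S₁ 1‖ + ‖S₂ (star a * a)‖) * ‖ξ‖ * ‖η‖)).ultrafilter_le_nhds'
      (U.map (fun s => φ s a ξ η)) (by
        show _ ∈ (U : Filter (Finset H)).map _
        rw [Filter.mem_map]
        filter_upwards [hev ξ, hev η] with s h1 h2
        rw [Set.mem_preimage, mem_closedBall_zero_iff]
        exact aux_bound S₁ S₂ (φ s) (hT s) _ (hP s) a ξ η h1 h2)
    exact ⟨z, hz⟩
  choose ψ hψ using hlim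
  refine ⟨ψ, ⟨?_, ?_, ?_, ?_, ?_, ?_⟩, ?_, ?_⟩
  · intro a b ξ η
    refine tendsto_nhds_unique (hψ _ _ _) (((hψ a ξ η).add (hψ b ξ η)).congr fun s => ?_)
    exact ((hT s).addA _ _ _ _).symm
  · intro c a ξ η
    refine tendsto_nhds_unique (hψ _ _ _) (((hψ a ξ η).const_mul c).congr fun s => ?_)
    exact ((hT s).smulA _ _ _ _).symm
  · intro a ξ ξ' η
    refine tendsto_nhds_unique (hψ _ _ _) (((hψ a ξ η).add (hψ a ξ' η)).congr fun s => ?_)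
    exact ((hT s).addL _ _ _ _).symm
  · intro c a ξ η
    refine tendsto_nhds_unique (hψ _ _ _) (((hψ a ξ η).const_mul (star c)).congr fun s => ?_)
    exact ((hT s).smulL _ _ _ _).symm
  · intro a ξ η η'
    refine tendsto_nhds_unique (hψ _ _ _) (((hψ a ξ η).add (hψ a ξ η')).congr fun s => ?_)
    exact ((hT s).addR _ _ _ _).symm
  · intro c a ξ η
    refine tendsto_nhds_unique (hψ _ _ _) (((hψ a ξ η).const_mul c).congr fun s => ?_)
    exact ((hT s).smulR _ _ _ _).symm
  · intro m a v w
    unfold AuxPos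
    have h1 : Filter.Tendsto (fun s => ∑ k, ∑ l, φ s (star (a k) * a l) (v k) (w l)) U
        (nhds (∑ k, ∑ l, ψ (star (a k) * a l) (v k) (w l))) :=
      tendsto_finsetSum _ fun k _ => tendsto_finsetSum _ fun l _ => hψ _ _ _
    have h2 := (((Complex.continuous_re.tendsto _).comp h1).const_mul 2)
    refine ge_of_tendsto ((h2.const_add _).add_const _) ?_
    filter_upwards [Filter.eventually_all.2 fun k => hev (v k),
      Filter.eventually_all.2 fun k => hev (w k)] with s h3 h4
    exact hP s a v w h3 h4
  · intro ξ
    unfold AuxBd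
    have h2 := (((Complex.continuous_re.tendsto _).comp (hψ 1 ξ ξ)).const_mul 2)
    refine le_of_tendsto (h2.const_sub _) ?_
    filter_upwards [hev ξ] with s h3
    exact hB s ξ h3

theorem aux_op {A H : Type*} [CStarAlgebra A]
    [NormedAddCommGroup H] [InnerProductSpace ℂ H] [CompleteSpace H]
    (φ : A → H → H → ℂ) (hφ : AuxTri φ) (C : A → ℝ)
    (hC : ∀ a ξ η, ‖φ a ξ η‖ ≤ C a * ‖ξ‖ * ‖η‖) :
    ∃ R : A →ₗ[ℂ] (H →L[ℂ] H), ∀ a ξ η, inner ℂ ξ (R a η) = φ a ξ η := by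
  let B : A → (H →L⋆[ℂ] H →L[ℂ] ℂ) := fun a =>
    LinearMap.mkContinuous₂ (LinearMap.mk₂'ₛₗ (starRingEnd ℂ) (RingHom.id ℂ) (φ a)
      (hφ.addL a) (fun c ξ η => by rw [hφ.smulL]; rfl) (hφ.addR a)
      (fun c ξ η => by rw [hφ.smulR]; rfl)) (C a) (hC a)
  let R : A → (H →L[ℂ] H) := fun a =>
    ContinuousLinearMap.adjoint (InnerProductSpace.continuousLinearMapOfBilin (B a))
  have hR : ∀ a ξ η, inner ℂ ξ (R a η) = φ a ξ η := by
    intro a ξ η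
    rw [ContinuousLinearMap.adjoint_inner_right,
      InnerProductSpace.continuousLinearMapOfBilin_apply]
    rfl
  refine ⟨{ toFun := R, map_add' := ?_, map_smul' := ?_ }, hR⟩
  · intro a b
    ext η
    refine ext_inner_left ℂ fun ξ => ?_
    rw [hR, add_apply, inner_add_right, hR, hR, hφ.addA]
  · intro c a
    ext η
    refine ext_inner_left ℂ fun ξ => ?_
    rw [hR, RingHom.id_apply, smul_apply, inner_smul_right, hR, hφ.smulA]

end

section

open scoped ComplexOrder

theorem aux_mat {H κ : Type*} [NormedAddCommGroup H] [InnerProductSpace ℂ H] [CompleteSpace H]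
    [Fintype κ] [DecidableEq κ] (X : Matrix κ κ (H →L[ℂ] H))
    (hX : ∀ w : κ → H, 0 ≤ ∑ i, ∑ j, (inner ℂ (w i) (X i j (w j)) : ℂ)) :
    ∃ z : Matrix κ κ (H →L[ℂ] H), X = star z * z := by
  let pr : κ → (PiLp 2 (fun _ : κ => H) →L[ℂ] H) := fun i => PiLp.proj 2 (fun _ : κ => H) i
  let inc : κ → (H →L[ℂ] PiLp 2 (fun _ : κ => H)) := fun i =>
    (PiLp.continuousLinearEquiv 2 ℂ (fun _ : κ => H)).symm.toContinuousLinearMap ∘L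
      (ContinuousLinearMap.single ℂ (fun _ : κ => H) i)
  have hinc : ∀ i ξ j, (inc i ξ) j = if j = i then ξ else 0 := by
    intro i ξ j
    simp [inc, Pi.single_apply]
  let T : PiLp 2 (fun _ : κ => H) →L[ℂ] PiLp 2 (fun _ : κ => H) := ∑ i, ∑ j, inc i ∘L X i j ∘L pr j
  have hin : ∀ (i : κ) (ξ : H) (u : PiLp 2 (fun _ : κ => H)), inner ℂ u (inc i ξ) = inner ℂ (u i) ξ := by
    intro i ξ u
    rw [PiLp.inner_apply]
    simp only [hinc]
    rw [Finset.sum_eq_single i] <;> simp +contextual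
  have hT : ∀ u v : PiLp 2 (fun _ : κ => H), inner ℂ u (T v) = ∑ i, ∑ j, (inner ℂ (u i) (X i j (v j)) : ℂ) := by
    intro u v
    simp only [T, ContinuousLinearMap.sum_apply, inner_sum, ContinuousLinearMap.comp_apply, hin]
    rfl
  have hpos : (0 : PiLp 2 (fun _ : κ => H) →L[ℂ] PiLp 2 (fun _ : κ => H)) ≤ T := by
    rw [ContinuousLinearMap.nonneg_iff_isPositive, ContinuousLinearMap.isPositive_iff_complex]
    intro u
    have h := hX u
    rw [← hT u u] at h
    obtain ⟨h1, h2⟩ := Complex.nonneg_iff.1 h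
    have h3 : inner ℂ (T u) u = inner ℂ u (T u) := by
      rw [← inner_conj_symm]
      exact Complex.conj_eq_iff_im.2 h2.symm
    rw [h3]
    refine ⟨?_, ?_⟩
    · apply Complex.ext
      · simp
      · simp [← h2]
    · simpa using h1
  obtain ⟨Z, hZ⟩ := (aux_nonneg_iff T).1 hpos
  refine ⟨Matrix.of fun i j => pr i ∘L Z ∘L inc j, ?_⟩
  ext i j η
  refine ext_inner_left ℂ fun ξ => ?_
  have h1 : inner ℂ (inc i ξ) (T (inc j η)) = inner ℂ ξ (X i j η) := by
    rw [hT, Finset.sum_eq_single i, Finset.sum_eq_single j]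
    · simp [hinc]
    · intro b _ hb; simp [hinc, hb]
    · simp
    · intro b _ hb; simp [hinc, hb]
    · simp
  rw [← h1, hZ]
  have h2 : inner ℂ (inc i ξ) ((star Z * Z) (inc j η)) = inner ℂ (Z (inc i ξ)) (Z (inc j η)) := by
    rw [ContinuousLinearMap.star_eq_adjoint, ContinuousLinearMap.mul_apply,
      ContinuousLinearMap.adjoint_inner_right]
  rw [h2, PiLp.inner_apply, Matrix.mul_apply, ContinuousLinearMap.sum_apply, inner_sum]
  refine Finset.sum_congr rfl fun k _ => ?_
  rw [Matrix.star_apply, ContinuousLinearMap.star_eq_adjoint, ContinuousLinearMap.mul_apply,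
      ContinuousLinearMap.adjoint_inner_right]
  rfl

/-- the block map -/
noncomputable def auxHat {A H : Type*} [CStarAlgebra A] [NormedAddCommGroup H] [InnerProductSpace ℂ H]
    [CompleteSpace H] (S₁ S₂ R : A →ₗ[ℂ] (H →L[ℂ] H)) :
    A →ₗ[ℂ] Matrix (Fin 2) (Fin 2) (H →L[ℂ] H) where
  toFun a := !![S₁ a, R a; star (R (star a)), S₂ a]
  map_add' a b := by
    ext i j : 2
    fin_cases i <;> fin_cases j <;> simp
  map_smul' c a := by
    ext i j : 2
    fin_cases i <;> fin_cases j <;> simp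

theorem aux_hat {A H : Type*} [CStarAlgebra A] [NormedAddCommGroup H] [InnerProductSpace ℂ H]
    [CompleteSpace H] (S₁ S₂ R : A →ₗ[ℂ] (H →L[ℂ] H))
    (hS₁ : ∀ {n : ℕ} (w : Fin n → H) (x : CStarMatrix (Fin n) (Fin n) A),
      0 ≤ auxQf S₁ w (star x * x))
    (hS₂ : ∀ {n : ℕ} (w : Fin n → H) (x : CStarMatrix (Fin n) (Fin n) A),
      0 ≤ auxQf S₂ w (star x * x))
    (hpos : ∀ {m : ℕ} (a : Fin m → A) (v w : Fin m → H),
      AuxPos S₁ S₂ (fun a ξ η => inner ℂ ξ (R a η)) a v w)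
    {m : ℕ} (y : Matrix (Fin m) (Fin m) A) :
    ∃ z : Matrix (Fin m × Fin 2) (Fin m × Fin 2) (H →L[ℂ] H),
      (Matrix.of fun s t => auxHat S₁ S₂ R ((star y * y) s.1 t.1) s.2 t.2) = star z * z := by
  apply aux_mat
  intro w
  let v₁ : Fin m → H := fun i => w (i, 0)
  let v₂ : Fin m → H := fun i => w (i, 1)
  let x := star y * y
  have hx : ∀ i j, x i j = ∑ k, star (y k i) * y k j := by
    intro i j; simp [x, Matrix.mul_apply, Matrix.star_apply]
  have hxs : ∀ i j, star (x i j) = x j i := by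
    intro i j; simp [hx]
  let Q : ℂ := ∑ i, ∑ j, inner ℂ (v₁ i) (R (x i j) (v₂ j))
  have h1 := hS₁ v₁ (CStarMatrix.ofMatrix y)
  have h2 := hS₂ v₂ (CStarMatrix.ofMatrix y)
  rw [auxQf_apply] at h1 h2
  have e1 : ∀ i j, (star (CStarMatrix.ofMatrix y) * CStarMatrix.ofMatrix y) i j = x i j := by
    intro i j; rfl
  simp only [e1] at h1 h2
  have hQ : ∑ i, ∑ j, inner ℂ (v₂ i) ((star (R (star (x i j)))) (v₁ j)) = star Q := by
    rw [star_sum, Finset.sum_comm]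
    refine Finset.sum_congr rfl fun i _ => ?_
    rw [star_sum]
    refine Finset.sum_congr rfl fun j _ => ?_
    rw [hxs, ContinuousLinearMap.star_eq_adjoint, ContinuousLinearMap.adjoint_inner_right]
    exact (inner_conj_symm _ _).symm
  have htot : ∑ s, ∑ t, (inner ℂ (w s) ((Matrix.of fun s t : Fin m × Fin 2 =>
      auxHat S₁ S₂ R (x s.1 t.1) s.2 t.2) s t (w t)) : ℂ)
      = (∑ i, ∑ j, inner ℂ (v₁ i) (S₁ (x i j) (v₁ j))) + Q + star Q
        + ∑ i, ∑ j, inner ℂ (v₂ i) (S₂ (x i j) (v₂ j)) := by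
    rw [← hQ]
    simp only [Fintype.sum_prod_type, Fin.sum_univ_two, Matrix.of_apply, auxHat, LinearMap.coe_mk,
      AddHom.coe_mk, Finset.sum_add_distrib, Q]
    simp [v₁, v₂]
    abel
  change 0 ≤ ∑ s, ∑ t, (inner ℂ (w s) ((Matrix.of fun s t : Fin m × Fin 2 =>
      auxHat S₁ S₂ R (x s.1 t.1) s.2 t.2) s t (w t)) : ℂ)
  rw [htot]
  rw [Complex.nonneg_iff] at h1 h2 ⊢
  refine ⟨?_, ?_⟩
  swap
  · rw [Complex.add_im, Complex.add_im, Complex.add_im, ← h1.2, ← h2.2]; simp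
  have key : ∀ (S : A →ₗ[ℂ] (H →L[ℂ] H)) (u u' : Fin m → H),
      ∑ i, ∑ j, (inner ℂ (u i) (S (x i j) (u' j)) : ℂ) =
      ∑ k, ∑ i, ∑ j, inner ℂ (u i) (S (star (y k i) * y k j) (u' j)) := by
    intro S u u'
    rw [Finset.sum_comm (γ := Fin m) (s := Finset.univ) (t := Finset.univ)
      (f := fun k i => ∑ j, (inner ℂ (u i) (S (star (y k i) * y k j) (u' j)) : ℂ))]
    refine Finset.sum_congr rfl fun i _ => ?_
    rw [Finset.sum_comm (f := fun k j => (inner ℂ (u i) (S (star (y k i) * y k j) (u' j)) : ℂ))]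
    refine Finset.sum_congr rfl fun j _ => ?_
    rw [hx, map_sum, ContinuousLinearMap.sum_apply, inner_sum]
  have h3 := Finset.sum_nonneg fun k (_ : k ∈ Finset.univ) => hpos (fun i => y k i) v₁ v₂
  rw [Finset.sum_add_distrib, Finset.sum_add_distrib, ← Finset.mul_sum, ← Complex.re_sum,
    ← Complex.re_sum, ← Complex.re_sum, ← key, ← key, ← key] at h3
  simp only [Complex.add_re, Complex.star_def, Complex.conj_re]
  change 0 ≤ _ + 2 * Q.re + _ at h3
  linarith

theorem aux_hat_cp {A B H : Type*} [CStarAlgebra A] [CStarAlgebra B]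
    [NormedAddCommGroup H] [InnerProductSpace ℂ H]
    [CompleteSpace H] (S₁ S₂ R : A →ₗ[ℂ] (H →L[ℂ] H))
    (P : (H →L[ℂ] H) →ₗ[ℂ] B) (hP : IsCPMap P)
    (hS₁ : ∀ {n : ℕ} (w : Fin n → H) (x : CStarMatrix (Fin n) (Fin n) A),
      0 ≤ auxQf S₁ w (star x * x))
    (hS₂ : ∀ {n : ℕ} (w : Fin n → H) (x : CStarMatrix (Fin n) (Fin n) A),
      0 ≤ auxQf S₂ w (star x * x))
    (hpos : ∀ {m : ℕ} (a : Fin m → A) (v w : Fin m → H),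
      AuxPos S₁ S₂ (fun a ξ η => inner ℂ ξ (R a η)) a v w) :
    IsCPMap (P.mapMatrix ∘ₗ auxHat S₁ S₂ R) := by
  rintro m x ⟨y, rfl⟩
  obtain ⟨z, hz⟩ := aux_hat S₁ S₂ R hS₁ hS₂ hpos y
  let e : Fin (m * 2) ≃ Fin m × Fin 2 := finProdFinEquiv.symm
  obtain ⟨Z, hZ⟩ := hP (m * 2) ((star z * z).submatrix e e) ⟨z.submatrix e e, by
    rw [← Matrix.submatrix_mul_equiv (e₂ := e)]; rfl⟩
  refine ⟨Matrix.of fun i j => Matrix.of fun p q => Z (e.symm (i, p)) (e.symm (j, q)), ?_⟩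
  ext i j p q
  have h := congrFun (congrFun hZ (e.symm (i, p))) (e.symm (j, q))
  rw [← hz] at h
  simp only [Matrix.map_apply, Matrix.submatrix_apply, Equiv.apply_symm_apply, Matrix.of_apply,
    Matrix.mul_apply (M := star Z), Matrix.star_apply] at h
  rw [Matrix.map_apply, Matrix.mul_apply (M := star (_ : Matrix (Fin m) (Fin m) (Matrix (Fin 2) (Fin 2) B))), Matrix.sum_apply]
  simp only [Matrix.star_apply, Matrix.mul_apply (m := Fin 2)]
  rw [← Fintype.sum_prod_type', ← e.sum_comp]
  refine h.trans ?_
  refine Finset.sum_congr rfl fun k _ => ?_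
  simp

theorem aux_final {A B H : Type*} [CStarAlgebra A] [CStarAlgebra B]
    [NormedAddCommGroup H] [InnerProductSpace ℂ H]
    [CompleteSpace H] (S₁ S₂ R : A →ₗ[ℂ] (H →L[ℂ] H))
    (P : (H →L[ℂ] H) →ₗ[ℂ] B) (hP : IsCPMap P) (hP1 : P 1 = 1) (α : ℝ) (hα : 0 ≤ α)
    (hS₁ : ∀ ξ, (inner ℂ ξ (S₁ 1 ξ) : ℂ).im = 0) (hS₂ : ∀ ξ, (inner ℂ ξ (S₂ 1 ξ) : ℂ).im = 0)
    (hpos : ∀ {m : ℕ} (a : Fin m → A) (v w : Fin m → H),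
      AuxPos S₁ S₂ (fun a ξ η => inner ℂ ξ (R a η)) a v w)
    (hbd : ∀ ξ, AuxBd S₁ S₂ α (fun a ξ η => inner ℂ ξ (R a η)) ξ) :
    ‖P (S₁ 1 + S₂ 1 - R 1 - star (R 1))‖ ≤ α := by
  let _ := CStarAlgebra.spectralOrder B
  have _ := CStarAlgebra.spectralOrderedRing B
  have hform : ∀ ξ, inner ℂ ξ ((S₁ 1 + S₂ 1 - R 1 - star (R 1)) ξ) =
      (((inner ℂ ξ (S₁ 1 ξ) : ℂ).re + (inner ℂ ξ (S₂ 1 ξ) : ℂ).re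
        - 2 * (inner ℂ ξ (R 1 ξ) : ℂ).re : ℝ) : ℂ) := by
    intro ξ
    have h : inner ℂ ξ (star (R 1) ξ) = star (inner ℂ ξ (R 1 ξ) : ℂ) := by
      rw [ContinuousLinearMap.star_eq_adjoint, ContinuousLinearMap.adjoint_inner_right]
      exact (inner_conj_symm _ _).symm
    simp only [ContinuousLinearMap.sub_apply, ContinuousLinearMap.add_apply, inner_sub_right, inner_add_right, h]
    have h1 := hS₁ ξ
    have h2 := hS₂ ξ
    clear h
    generalize (inner ℂ ξ (R 1 ξ) : ℂ) = r
    generalize (inner ℂ ξ (S₁ 1 ξ) : ℂ) = s at *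
    generalize (inner ℂ ξ (S₂ 1 ξ) : ℂ) = t at *
    apply Complex.ext
    · simp; ring
    · simp [h1, h2]
  obtain ⟨X, hX⟩ : ∃ X, X = S₁ 1 + S₂ 1 - R 1 - star (R 1) := ⟨_, rfl⟩
  rw [← hX] at hform ⊢
  have hPp : ∀ Y : H →L[ℂ] H, (∀ ξ, 0 ≤ (inner ℂ ξ (Y ξ) : ℂ)) → 0 ≤ P Y := by
    intro Y hY
    obtain ⟨z, hz⟩ := aux_mat (κ := Fin 1) (fun _ _ => Y) (fun w => by simpa using hY (w 0))
    have := congrFun (congrFun hz 0) 0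
    simp [Matrix.mul_apply, Matrix.star_apply] at this
    rw [this]
    obtain ⟨u, hu⟩ := aux_cp_nonneg P hP (z 0 0)
    rw [hu]; exact star_mul_self_nonneg u
  have h0 : 0 ≤ P X := by
    apply hPp
    intro ξ
    rw [hform]
    have := hpos (m := 1) (fun _ => 1) (fun _ => ξ) (fun _ => -ξ)
    simp [AuxPos] at this
    rw [Complex.zero_le_real]
    linarith
  have h1 : 0 ≤ P ((α : ℂ) • 1 - X) := by
    apply hPp
    intro ξ
    rw [ContinuousLinearMap.sub_apply, inner_sub_right, hform, ContinuousLinearMap.smul_apply, ContinuousLinearMap.one_apply, inner_smul_right,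
      inner_self_eq_norm_sq_to_K]
    have := hbd ξ
    unfold AuxBd at this
    simp only at this
    have h : (0:ℂ) ≤ ((α * ‖ξ‖ ^ 2 - ((inner ℂ ξ (S₁ 1 ξ) : ℂ).re + (inner ℂ ξ (S₂ 1 ξ) : ℂ).re
        - 2 * (inner ℂ ξ (R 1 ξ) : ℂ).re) : ℝ) : ℂ) := by
      rw [Complex.zero_le_real]; linarith
    simpa using h
  rw [map_sub, map_smul, hP1, sub_nonneg] at h1
  rw [CStarAlgebra.norm_le_iff_le_algebraMap _ hα h0]
  rwa [Algebra.algebraMap_eq_smul_one, ← Complex.coe_smul]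

end

theorem stmt13 {A B : Type*} [CStarAlgebra A] [CStarAlgebra B]
    {H : Type*} [NormedAddCommGroup H] [InnerProductSpace ℂ H] [CompleteSpace H]
    -- an isometric *-homomorphism `ι : B → B(H)`
    (ι : B →⋆ₐ[ℂ] (H →L[ℂ] H)) (hι : ∀ b : B, ‖ι b‖ = ‖b‖)
    -- a completely positive conditional expectation `P : B(H) → B` onto the image of `B`
    (P : (H →L[ℂ] H) →ₗ[ℂ] B) (hP : IsCPMap P) (hPι : ∀ b : B, P (ι b) = b)
    (T₁ T₂ : A →ₗ[ℂ] B) (hT₁ : IsCPMap T₁) (hT₂ : IsCPMap T₂)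
    (νA : ∀ n : ℕ, Matrix (Fin n) (Fin n) A → ℝ)
    (νB : ∀ n : ℕ, Matrix (Fin n) (Fin n) B → ℝ)
    (hνA : ∀ n, IsCStarNorm (νA n)) (hνB : ∀ n, IsCStarNorm (νB n))
    (α : ℝ) (hα : 0 ≤ α)
    -- the cb-norm of `T₁ - T₂` is at most `α`
    (hcb : ∀ (n : ℕ) (x : Matrix (Fin n) (Fin n) A),
      νB n (x.map (fun a => T₁ a - T₂ a)) ≤ α * νA n x) :
    buresDist (⇑T₁) (⇑T₂) ^ 2 ≤ α := by
  open scoped ComplexOrder in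
  let _ := CStarAlgebra.spectralOrder A
  have _ := CStarAlgebra.spectralOrderedRing A
  obtain ⟨S₁, hS₁⟩ : ∃ S, S = ι.toAlgHom.toLinearMap ∘ₗ T₁ := ⟨_, rfl⟩
  obtain ⟨S₂, hS₂⟩ : ∃ S, S = ι.toAlgHom.toLinearMap ∘ₗ T₂ := ⟨_, rfl⟩
  have hS₁a : ∀ a, S₁ a = ι (T₁ a) := by intro a; rw [hS₁]; rfl
  have hS₂a : ∀ a, S₂ a = ι (T₂ a) := by intro a; rw [hS₂]; rfl
  have hq₁ : ∀ {n : ℕ} (w : Fin n → H) (x : CStarMatrix (Fin n) (Fin n) A),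
      0 ≤ auxQf S₁ w (star x * x) := by
    intro n w x; rw [hS₁]; exact aux_qf_nonneg ι T₁ hT₁ w x
  have hq₂ : ∀ {n : ℕ} (w : Fin n → H) (x : CStarMatrix (Fin n) (Fin n) A),
      0 ≤ auxQf S₂ w (star x * x) := by
    intro n w x; rw [hS₂]; exact aux_qf_nonneg ι T₂ hT₂ w x
  obtain ⟨φ, hφ, hpos, hbd⟩ := aux_lim S₁ S₂ α (fun s =>
    aux_fin S₁ S₂ α hq₁ hq₂ (fun {n} w x hx hx1 => by
      rw [hS₁, hS₂]
      exact aux_cb ι T₁ T₂ hT₁ hT₂ νA νB hνA hνB α hα hcb w x hx hx1) _)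
  obtain ⟨R, hR⟩ := aux_op φ hφ _ (fun a ξ η => aux_bound S₁ S₂ φ hφ ⊤
    (fun a v w _ _ => hpos a v w) a ξ η trivial trivial)
  obtain rfl : φ = fun a ξ η => inner ℂ ξ (R a η) := by
    funext a ξ η; rw [hR]
  have him : ∀ (S : A →ₗ[ℂ] (H →L[ℂ] H)), (∀ {n : ℕ} (w : Fin n → H)
      (x : CStarMatrix (Fin n) (Fin n) A), 0 ≤ auxQf S w (star x * x)) →
      ∀ ξ, (inner ℂ ξ (S 1 ξ) : ℂ).im = 0 := by
    intro S hS ξ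
    have h := hS (n := 1) (fun _ => ξ) 1
    rw [auxQf_apply] at h
    have h := (Complex.nonneg_iff.1 h).2
    simpa [CStarMatrix.one_apply] using h.symm
  have hn := aux_final S₁ S₂ R P hP (by rw [← map_one ι]; exact hPι 1) α hα (him S₁ hq₁) (him S₂ hq₂)
    hpos hbd
  unfold buresDist
  rw [Real.sq_sqrt]
  swap
  · apply Real.sInf_nonneg
    rintro r ⟨_, _, rfl⟩
    exact norm_nonneg _
  refine csInf_le_of_le (b := ‖T₁ 1 + T₂ 1 - (P.mapMatrix ∘ₗ auxHat S₁ S₂ R) 1 0 1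
      - (P.mapMatrix ∘ₗ auxHat S₁ S₂ R) 1 1 0‖) ⟨0, ?_⟩ ⟨P.mapMatrix ∘ₗ auxHat S₁ S₂ R,
    ⟨aux_hat_cp S₁ S₂ R P hP hq₁ hq₂ hpos, ?_, ?_⟩, rfl⟩ ?_
  · rintro r ⟨_, _, rfl⟩
    exact norm_nonneg _
  · intro a
    simp [auxHat, hS₁a, hPι]
  · intro a
    simp [auxHat, hS₂a, hPι]
  · refine le_trans (le_of_eq ?_) hn
    simp [auxHat, hS₁a, hS₂a, hPι]
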